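/- arXiv:1704.08720 — 3 statements merged into one kernel-verified Lean document; each statement's English description precedes it below -/
import Mathlib

section
/- Let H be a separable complex Hilbert space, and let N : B(H) → B(H) be a bounded linear map which is positive (i.e., maps nonnegative operators to nonnegative operators) and which maps the trace class S^1 into itself boundedly; let N* : B(H) → B(H) denote the dual map determined by tr(N*(Y) X) = tr(Y N(X)) for all X ∈ S^1 and Y ∈ B(H). Then for any 1 < p < ∞ and any X ∈ S^p, one has ‖N(X)‖_{S^p} ≤ ‖N(1)‖_B^{1/p'} · ‖N*(1)‖_B^{1/p} · ‖X‖_{S^p}, where p' = p/(p−1). In other words, ‖N‖_{S^p → S^p} ≤ ‖N(1)‖_B^{1/p'} ‖N*(1)‖_B^{1/p}. -/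
open scoped ENNReal InnerProductSpace

noncomputable section

variable {H : Type*} [NormedAddCommGroup H] [InnerProductSpace ℂ H] [CompleteSpace H]

/-- `|T|^q = (T^* T)^{q/2}`, defined via the continuous functional calculus. -/
def absPow (T : H →L[ℂ] H) (q : ℝ) : H →L[ℂ] H :=
  cfc (fun x : ℝ => x ^ (q / 2)) (ContinuousLinearMap.adjoint T * T)

/-- `tr |T|^q ∈ [0,∞]`, computed via the diagonal matrix elements in the Hilbert
basis `b`.  For `q = 1` this is the trace norm `‖T‖_{S¹}`, and `T` belongs to the
Schatten class `S^q` precisely when this quantity is finite. -/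
def trAbsPow {ι : Type*} (b : HilbertBasis ι ℂ H) (T : H →L[ℂ] H) (q : ℝ) : ℝ≥0∞ :=
  ∑' i, ENNReal.ofReal (⟪b i, (absPow T q) (b i)⟫_ℂ).re

/-- The Schatten `p`-norm `‖T‖_{S^p} = (tr (T^*T)^{p/2})^{1/p} ∈ [0,∞]`. -/
def schattenNorm {ι : Type*} (b : HilbertBasis ι ℂ H) (p : ℝ) (T : H →L[ℂ] H) : ℝ≥0∞ :=
  (trAbsPow b T p) ^ (1 / p)

/-- The trace `tr T = ∑ᵢ ⟨bᵢ, T bᵢ⟩` (a convergent sum when `T` is trace class). -/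
def traceC {ι : Type*} (b : HilbertBasis ι ℂ H) (T : H →L[ℂ] H) : ℂ :=
  ∑' i, ⟪b i, T (b i)⟫_ℂ

set_option linter.unusedSectionVars false

/-- A linear isometry of a finite-dimensional complex inner product space is diagonal in a
suitable orthonormal basis. -/
lemma LinearIsometryEquiv.exists_orthonormalBasis_eigenvectors {K : Type*} [NormedAddCommGroup K]
    [InnerProductSpace ℂ K] [FiniteDimensional ℂ K] (V : K ≃ₗᵢ[ℂ] K) :
    ∃ (n : ℕ) (w : OrthonormalBasis (Fin n) ℂ K), ∀ i, ∃ c : ℂ, ‖c‖ = 1 ∧ V (w i) = c • w i := by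
  classical
  set T : Module.End ℂ K := (V : K →ₗ[ℂ] K) with hT
  have hTV : ∀ x, T x = V x := fun x => rfl
  have hunit : ∀ (c : ℂ) (x : K), x ≠ 0 → T x = c • x → ‖c‖ = 1 := by
    intro c x hx h
    have h1 : ‖V x‖ = ‖c‖ * ‖x‖ := by rw [← hTV, h, norm_smul]
    rw [V.norm_map] at h1
    have := norm_pos_iff.2 hx
    exact (mul_right_cancel₀ this.ne' (by rw [one_mul]; exact h1)).symm
  have hortho : OrthogonalFamily ℂ (fun c : Module.End.Eigenvalues T => Module.End.eigenspace T c)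
      (fun c => (Module.End.eigenspace T c).subtypeₗᵢ) := by
    rintro c d hcd ⟨x, hx⟩ ⟨y, hy⟩
    change inner ℂ x y = 0
    rw [Module.End.mem_eigenspace_iff] at hx hy
    by_cases hx0 : x = 0
    · simp [hx0]
    have hc : ‖(c : ℂ)‖ = 1 := hunit _ x hx0 hx
    have h1 : inner ℂ x y = starRingEnd ℂ (c : ℂ) * (d : ℂ) * inner ℂ x y := by
      conv_lhs => rw [← V.inner_map_map, ← hTV, ← hTV, hx, hy, inner_smul_left, inner_smul_right]
      ring
    by_contra hne
    have h2 : starRingEnd ℂ (c : ℂ) * (d : ℂ) = 1 :=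
      mul_right_cancel₀ hne (by rw [one_mul]; exact h1.symm)
    have h3 : (c : ℂ) * starRingEnd ℂ (c : ℂ) = 1 := by
      rw [Complex.mul_conj, Complex.normSq_eq_norm_sq, hc]; simp
    apply hcd
    apply Subtype.ext
    change (c : ℂ) = (d : ℂ)
    linear_combination (-(c : ℂ)) * h2 + (d : ℂ) * h3
  have htop : (⨆ c : Module.End.Eigenvalues T, Module.End.eigenspace T c)ᗮ = ⊥ := by
    set W : Submodule ℂ K := ⨆ c : Module.End.Eigenvalues T, Module.End.eigenspace T c with hW
    have hle : ∀ c : ℂ, Module.End.eigenspace T c ≤ W := by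
      intro c
      by_cases hc : T.HasEigenvalue c
      · exact le_iSup (fun c : Module.End.Eigenvalues T => Module.End.eigenspace T c) ⟨c, hc⟩
      · have : Module.End.eigenspace T c = ⊥ := by
          by_contra h
          exact hc (Module.End.hasEigenvalue_iff.2 h)
        rw [this]; exact bot_le
    have hmap : W ≤ W.map T := by
      apply iSup_le
      intro c x hx
      have hx' := hx
      rw [Module.End.mem_eigenspace_iff] at hx
      by_cases hx0 : x = 0
      · rw [hx0]; exact zero_mem _
      have hc : (c : ℂ) ≠ 0 := by
        intro h
        have := hunit _ x hx0 hx
        change ‖(c : ℂ)‖ = 1 at this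
        rw [h] at this; simp at this
      refine ⟨(c : ℂ)⁻¹ • x, W.smul_mem _ (hle _ hx'), ?_⟩
      exact (T.map_smul _ _).trans (by rw [hx]; exact inv_smul_smul₀ hc x)
    have hinv : ∀ x ∈ Wᗮ, T x ∈ Wᗮ := by
      intro x hx
      rw [Submodule.mem_orthogonal]
      intro y hy
      obtain ⟨z, hz, rfl⟩ := hmap hy
      rw [hTV, hTV, V.inner_map_map]
      exact (Submodule.mem_orthogonal _ _).1 hx z hz
    by_contra hne
    have : Nontrivial Wᗮ := Submodule.nontrivial_iff_ne_bot.2 hne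
    obtain ⟨c, hc⟩ := Module.End.exists_eigenvalue (T.restrict hinv)
    obtain ⟨x, hx⟩ := hc.exists_hasEigenvector
    have hx1 := Module.End.mem_eigenspace_iff.1 hx.1
    have hx2 : T (x : K) = c • (x : K) := congrArg Subtype.val hx1
    have hx3 : (x : K) ∈ W := hle c (Module.End.mem_eigenspace_iff.2 hx2)
    have : (x : K) = 0 := by
      rw [← inner_self_eq_zero (𝕜 := ℂ)]
      exact (Submodule.mem_orthogonal _ _).1 x.2 _ hx3
    exact hx.2 (Subtype.ext this)
  have hint : DirectSum.IsInternal (fun c : Module.End.Eigenvalues T => Module.End.eigenspace T c) :=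
    hortho.isInternal_iff.2 htop
  refine ⟨_, hint.subordinateOrthonormalBasis rfl hortho, fun i => ?_⟩
  have h := hint.subordinateOrthonormalBasis_subordinate rfl i hortho
  rw [Module.End.mem_eigenspace_iff] at h
  exact ⟨_, hunit _ _ ((hint.subordinateOrthonormalBasis rfl hortho).orthonormal.ne_zero i) h, h⟩

lemma Complex.exists_norm_eq_one_mul_eq_norm (z : ℂ) : ∃ c : ℂ, ‖c‖ = 1 ∧ c * z = ‖z‖ := by
  by_cases hz : z = 0
  · exact ⟨1, by simp, by simp [hz]⟩
  · have h : (‖z‖ : ℂ) ≠ 0 := by simpa using hz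
    refine ⟨starRingEnd ℂ z / ‖z‖, by simp [hz], ?_⟩
    rw [div_mul_eq_mul_div, mul_comm, Complex.mul_conj, Complex.normSq_eq_norm_sq]
    push_cast
    field_simp

/-- The sum of the diagonal entries of a sesquilinear form does not depend on the
orthonormal basis. -/
lemma OrthonormalBasis.sum_sesqForm_eq {K : Type*} [NormedAddCommGroup K]
    [InnerProductSpace ℂ K] {α β : Type*} [Fintype α] [Fintype β]
    (e : OrthonormalBasis α ℂ K) (w : OrthonormalBasis β ℂ K)
    (Φ : K →ₗ⋆[ℂ] K →ₗ[ℂ] ℂ) : ∑ k, Φ (e k) (e k) = ∑ l, Φ (w l) (w l) := by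
  classical
  have h1 : ∀ l, Φ (w l) (w l) = ∑ k, inner ℂ (e k) (w l) * Φ (w l) (e k) := by
    intro l
    conv_lhs => enter [2]; rw [← e.sum_repr' (w l)]
    simp
  have h2 : ∀ k, Φ (e k) (e k) = ∑ l, inner ℂ (e k) (w l) * Φ (w l) (e k) := by
    intro k
    conv_lhs => enter [1]; rw [← w.sum_repr' (e k)]
    simp
  simp_rw [h1, h2]
  exact Finset.sum_comm

/-- For a sesquilinear form, absolute sums over two orthonormal bases are dominated by an absolute
diagonal sum over a single one. -/
lemma exists_orthonormalBasis_sum_norm_le {K : Type*} [NormedAddCommGroup K]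
    [InnerProductSpace ℂ K] {n : ℕ} (e f : OrthonormalBasis (Fin n) ℂ K)
    (Φ : K →ₗ⋆[ℂ] K →ₗ[ℂ] ℂ) :
    ∃ (m : ℕ) (w : OrthonormalBasis (Fin m) ℂ K),
      ∑ k, ‖Φ (e k) (f k)‖ ≤ ∑ l, ‖Φ (w l) (w l)‖ := by
  have : FiniteDimensional ℂ K := e.toBasis.finiteDimensional_of_finite
  choose c hc hcΦ using fun k => Complex.exists_norm_eq_one_mul_eq_norm (Φ (e k) (f k))
  have hcf : Orthonormal ℂ (fun k => c k • f k) := by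
    refine ⟨fun k => by simp [norm_smul, hc], fun i j hij => ?_⟩
    simp [inner_smul_left, inner_smul_right, f.orthonormal.2 hij]
  obtain ⟨g, hg⟩ := Orthonormal.exists_orthonormalBasis_extension_of_card_eq
    (ι := Fin n) (𝕜 := ℂ) (E := K) (by simp [Module.finrank_eq_card_basis e.toBasis])
    (v := fun k => c k • f k) (s := Set.univ) (hcf.comp _ Subtype.val_injective)
  set V : K ≃ₗᵢ[ℂ] K := e.equiv g (Equiv.refl _)
  have hV : ∀ k, V (e k) = c k • f k := by
    intro k
    simp [V, hg k]
  obtain ⟨m, w, hw⟩ := V.exists_orthonormalBasis_eigenvectors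
  refine ⟨m, w, ?_⟩
  have hsum := e.sum_sesqForm_eq w (Φ.compl₂ (V : K →ₗ[ℂ] K))
  simp only [LinearMap.compl₂_apply] at hsum
  have hleft : ∑ k, Φ (e k) (V (e k)) = ((∑ k, ‖Φ (e k) (f k)‖ : ℝ) : ℂ) := by
    push_cast
    refine Finset.sum_congr rfl fun k _ => ?_
    rw [hV, map_smul, smul_eq_mul, hcΦ]
  have hright : ‖∑ l, Φ (w l) (V (w l))‖ ≤ ∑ l, ‖Φ (w l) (w l)‖ := by
    refine (norm_sum_le _ _).trans (Finset.sum_le_sum fun l _ => ?_)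
    obtain ⟨d, hd, hd'⟩ := hw l
    rw [hd', map_smul, norm_smul, hd, one_mul]
  have h0 : ‖((∑ k, ‖Φ (e k) (f k)‖ : ℝ) : ℂ)‖ = ∑ k, ‖Φ (e k) (f k)‖ := by
    rw [Complex.norm_real, Real.norm_of_nonneg (Finset.sum_nonneg fun _ _ => norm_nonneg _)]
  rw [← h0, ← hleft]
  exact (congrArg norm hsum).le.trans hright

/-- A finite orthonormal family of a finite-dimensional space is an initial segment of an
orthonormal basis. -/
lemma Orthonormal.exists_orthonormalBasis_castLE {K : Type*} [NormedAddCommGroup K]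
    [InnerProductSpace ℂ K] [FiniteDimensional ℂ K] {n : ℕ} {e : Fin n → K}
    (he : Orthonormal ℂ e) (hn : n ≤ Module.finrank ℂ K) :
    ∃ b : OrthonormalBasis (Fin (Module.finrank ℂ K)) ℂ K, ∀ k, b (Fin.castLE hn k) = e k := by
  obtain ⟨b, hb⟩ := Orthonormal.exists_orthonormalBasis_extension_of_card_eq
    (ι := Fin (Module.finrank ℂ K)) (𝕜 := ℂ) (E := K) (by simp)
    (v := fun i => if h : (i : ℕ) < n then e ⟨i, h⟩ else 0) (s := {i | (i : ℕ) < n}) (by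
      have h := he.comp (fun i : ({i | (i : ℕ) < n} : Set (Fin (Module.finrank ℂ K))) =>
        (⟨(i.1 : ℕ), i.2⟩ : Fin n)) (by
          intro i j hij
          exact Subtype.ext (Fin.ext (by simpa using hij)))
      convert h using 1
      ext i
      have hi : ((i : Fin (Module.finrank ℂ K)) : ℕ) < n := i.2
      simp [hi])
  refine ⟨b, fun k => ?_⟩
  rw [hb _ (by simp)]
  simp

/-- If the absolute diagonal sums of a sesquilinear form over orthonormal families are bounded by
`M`, so are the absolute sums over pairs of orthonormal families. -/
lemma Orthonormal.sum_norm_sesqForm_le {E : Type*} [NormedAddCommGroup E] [InnerProductSpace ℂ E]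
    (Φ : E →ₗ⋆[ℂ] E →ₗ[ℂ] ℂ) {M : ℝ}
    (hM : ∀ (m : ℕ) (w : Fin m → E), Orthonormal ℂ w → ∑ l, ‖Φ (w l) (w l)‖ ≤ M)
    {n : ℕ} {e f : Fin n → E} (he : Orthonormal ℂ e) (hf : Orthonormal ℂ f) :
    ∑ k, ‖Φ (e k) (f k)‖ ≤ M := by
  set K : Submodule ℂ E := Submodule.span ℂ (Set.range e ∪ Set.range f)
  have : FiniteDimensional ℂ K :=
    FiniteDimensional.span_of_finite ℂ ((Set.finite_range e).union (Set.finite_range f))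
  have heK : ∀ k, e k ∈ K := fun k => Submodule.subset_span (Or.inl ⟨k, rfl⟩)
  have hfK : ∀ k, f k ∈ K := fun k => Submodule.subset_span (Or.inr ⟨k, rfl⟩)
  have he' : Orthonormal ℂ (fun k => (⟨e k, heK k⟩ : K)) :=
    (K.subtypeₗᵢ.orthonormal_comp_iff).1 he
  have hf' : Orthonormal ℂ (fun k => (⟨f k, hfK k⟩ : K)) :=
    (K.subtypeₗᵢ.orthonormal_comp_iff).1 hf
  have hn : n ≤ Module.finrank ℂ K := by
    simpa using he'.linearIndependent.fintype_card_le_finrank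
  obtain ⟨be, hbe⟩ := he'.exists_orthonormalBasis_castLE hn
  obtain ⟨bf, hbf⟩ := hf'.exists_orthonormalBasis_castLE hn
  obtain ⟨m, w, hw⟩ := exists_orthonormalBasis_sum_norm_le be bf
    ((Φ.comp K.subtype).compl₂ K.subtype)
  have hsub : ∑ k, ‖Φ (e k) (f k)‖ ≤ ∑ k, ‖Φ (be k) (bf k)‖ := by
    have h : ∀ k, ‖Φ (e k) (f k)‖ =
        ‖Φ (be (Fin.castLE hn k)) (bf (Fin.castLE hn k))‖ := by
      intro k
      rw [hbe, hbf]
    simp_rw [h]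
    refine (Finset.sum_map Finset.univ (Fin.castLEEmb hn)
      (fun k => ‖Φ (be k) (bf k)‖)).symm.le.trans ?_
    exact Finset.sum_le_sum_of_subset_of_nonneg (Finset.subset_univ _)
      fun _ _ _ => norm_nonneg _
  exact hsub.trans (hw.trans (hM m (fun l => (w l : E)) (w.orthonormal.comp_linearIsometry
    K.subtypeₗᵢ)))

lemma isSelfAdjoint_adjoint_mul_self (T : H →L[ℂ] H) :
    IsSelfAdjoint (ContinuousLinearMap.adjoint T * T) :=
  IsSelfAdjoint.star_mul_self T

/-- The functional calculus acts on an eigenvector through the eigenvalue. -/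
lemma cfc_apply_eigenvector {A : H →L[ℂ] H} (hA : IsSelfAdjoint A) {f : ℝ → ℝ}
    (hf : Continuous f) {u : H} {t : ℝ} (h : A u = (t : ℂ) • u) :
    (cfc f A) u = (f t : ℂ) • u := by
  by_cases hu : u = 0
  · simp [hu]
  have ht : t ∈ spectrum ℝ A := by
    rw [spectrum.mem_iff]
    rintro ⟨U, hU⟩
    apply hu
    have h0 : (U : H →L[ℂ] H) u = 0 := by
      rw [hU]
      simp [h, Algebra.algebraMap_eq_smul_one]
    calc u = (((U⁻¹ : (H →L[ℂ] H)ˣ) : H →L[ℂ] H) * U) u := by simp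
      _ = 0 := by rw [mul_apply_eq_comp, h0, map_zero]
  have : CompactSpace (spectrum ℝ A) := isCompact_iff_compactSpace.1 (spectrum.isCompact A)
  have key : ∀ g : C(spectrum ℝ A, ℝ), (cfcHom hA g) u = (g ⟨t, ht⟩ : ℂ) • u := by
    intro g
    induction g using ContinuousMap.induction_on_of_compact with
    | const r =>
      have : ContinuousMap.const (spectrum ℝ A) r = algebraMap ℝ C(spectrum ℝ A, ℝ) r := rfl
      rw [this, AlgHomClass.commutes]
      simp [Algebra.algebraMap_eq_smul_one]
    | id => rw [cfcHom_id hA, h]; rfl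
    | star_id => rw [star_trivial, cfcHom_id hA, h]; rfl
    | add f g hf hg => rw [map_add, add_apply, hf, hg, ← add_smul]; simp
    | mul f g hf hg =>
      rw [map_mul, mul_apply_eq_comp, hg, map_smul, hf, smul_smul]
      simp [mul_comm]
    | frequently f hf =>
      have hc : IsClosed {g : C(spectrum ℝ A, ℝ) | (cfcHom hA g) u = (g ⟨t, ht⟩ : ℂ) • u} := by
        apply isClosed_eq
        · have := cfcHom_continuous (R := ℝ) hA
          fun_prop
        · fun_prop
      exact hc.mem_of_frequently_of_tendsto hf Filter.tendsto_id
  rw [cfc_apply f A hA hf.continuousOn, key]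
  rfl

lemma re_inner_cfc_nonneg (A : H →L[ℂ] H) {f : ℝ → ℝ}
    (hf : ∀ x ∈ spectrum ℝ A, 0 ≤ f x) (x : H) : 0 ≤ (⟪x, (cfc f A) x⟫_ℂ).re :=
  ((ContinuousLinearMap.nonneg_iff_isPositive _).1 (cfc_nonneg hf)).re_inner_nonneg_right x

lemma spectrum_adjoint_mul_self_nonneg (T : H →L[ℂ] H) {x : ℝ}
    (hx : x ∈ spectrum ℝ (ContinuousLinearMap.adjoint T * T)) : 0 ≤ x :=
  spectrum_nonneg_of_nonneg (star_mul_self_nonneg T) hx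

lemma absPow_isPositive (T : H →L[ℂ] H) (q : ℝ) : (absPow T q).IsPositive :=
  (ContinuousLinearMap.nonneg_iff_isPositive _).1
    (cfc_nonneg fun _ hx => Real.rpow_nonneg (spectrum_adjoint_mul_self_nonneg T hx) _)

section
variable {ι : Type*} (b : HilbertBasis ι ℂ H)

lemma HilbertBasis.hasSum_norm_inner_sq (x : H) :
    HasSum (fun i => ‖⟪b i, x⟫_ℂ‖ ^ 2) (‖x‖ ^ 2) := by
  have h := Complex.hasSum_re (b.hasSum_inner_mul_inner x x)
  have hterm : ∀ i, (⟪x, b i⟫_ℂ * ⟪b i, x⟫_ℂ).re = ‖⟪b i, x⟫_ℂ‖ ^ 2 := by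
    intro i
    rw [← inner_conj_symm x (b i), mul_comm, Complex.mul_conj, Complex.normSq_eq_norm_sq]
    norm_cast
  have hx : (⟪x, x⟫_ℂ).re = ‖x‖ ^ 2 := by
    rw [inner_self_eq_norm_sq_to_K]
    norm_cast
  simpa only [hterm, hx] using h

lemma HilbertBasis.tsum_ofReal_norm_inner_sq (x : H) :
    ∑' i, ENNReal.ofReal (‖⟪b i, x⟫_ℂ‖ ^ 2) = ENNReal.ofReal (‖x‖ ^ 2) := by
  rw [← (b.hasSum_norm_inner_sq x).tsum_eq]
  exact (ENNReal.ofReal_tsum_of_nonneg (fun _ => by positivity)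
    (b.hasSum_norm_inner_sq x).summable).symm

/-- The diagonal sum of a positive operator over an orthonormal family is at most the diagonal sum
over a Hilbert basis. -/
lemma Orthonormal.sum_ofReal_inner_le_tsum {P : H →L[ℂ] H} (hP : P.IsPositive) {m : ℕ}
    {w : Fin m → H} (hw : Orthonormal ℂ w) :
    ∑ l, ENNReal.ofReal (⟪w l, P (w l)⟫_ℂ).re ≤ ∑' i, ENNReal.ofReal (⟪b i, P (b i)⟫_ℂ).re := by
  have hP0 : 0 ≤ P := (ContinuousLinearMap.nonneg_iff_isPositive _).2 hP
  set Q := CFC.sqrt P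
  have hQ : IsSelfAdjoint Q := (CFC.sqrt_nonneg P).isSelfAdjoint
  have hQQ : Q * Q = P := CFC.sqrt_mul_sqrt_self P hP0
  have hsymm : ∀ x y, ⟪Q x, y⟫_ℂ = ⟪x, Q y⟫_ℂ := hQ.isSymmetric
  have hre : ∀ x, (⟪x, P x⟫_ℂ).re = ‖Q x‖ ^ 2 := by
    intro x
    rw [← hQQ, mul_apply_eq_comp, ← hsymm, inner_self_eq_norm_sq_to_K]
    norm_cast
  simp_rw [hre]
  calc ∑ l, ENNReal.ofReal (‖Q (w l)‖ ^ 2)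
      = ∑ l, ∑' i, ENNReal.ofReal (‖⟪w l, Q (b i)⟫_ℂ‖ ^ 2) := by
        refine Finset.sum_congr rfl fun l _ => ?_
        rw [← b.tsum_ofReal_norm_inner_sq]
        refine tsum_congr fun i => ?_
        rw [← hsymm, norm_inner_symm]
    _ = ∑' i, ∑ l, ENNReal.ofReal (‖⟪w l, Q (b i)⟫_ℂ‖ ^ 2) :=
        (Summable.tsum_finsetSum fun _ _ => ENNReal.summable).symm
    _ ≤ ∑' i, ENNReal.ofReal (‖Q (b i)‖ ^ 2) := by
        refine ENNReal.tsum_le_tsum fun i => ?_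
        rw [← ENNReal.ofReal_sum_of_nonneg fun _ _ => by positivity]
        exact ENNReal.ofReal_le_ofReal (hw.sum_inner_products_le _)

/-- Norm limits do not increase `tr |T|^q`. -/
lemma trAbsPow_le_of_tendsto {q : ℝ} (hq : 0 < q) {T : ℕ → H →L[ℂ] H} {T₀ : H →L[ℂ] H}
    (hT : Filter.Tendsto T Filter.atTop (nhds T₀)) {S : ℝ≥0∞}
    (hS : ∀ n, trAbsPow b (T n) q ≤ S) : trAbsPow b T₀ q ≤ S := by
  have hcont : Continuous fun x : ℝ => x ^ (q / 2) := Real.continuous_rpow_const (by positivity)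
  have hTT : Filter.Tendsto (fun n => ContinuousLinearMap.adjoint (T n) * T n) Filter.atTop
      (nhds (ContinuousLinearMap.adjoint T₀ * T₀)) :=
    (((ContinuousLinearMap.adjoint (𝕜 := ℂ) (E := H) (F := H)).continuous.tendsto T₀).comp hT).mul hT
  set A₀ := ContinuousLinearMap.adjoint T₀ * T₀
  have habs : Filter.Tendsto (fun n => absPow (T n) q) Filter.atTop (nhds (absPow T₀ q)) := by
    refine Filter.Tendsto.cfc
      (isCompact_closedBall (0 : ℝ) ((‖A₀‖ + 1) * ‖(1 : H →L[ℂ] H)‖)) _ hTT ?_ ?_ ?_ ?_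
      hcont.continuousOn
    · have : ∀ᶠ n in Filter.atTop, ‖ContinuousLinearMap.adjoint (T n) * T n‖ < ‖A₀‖ + 1 :=
        hTT.norm.eventually_lt_const (by linarith)
      filter_upwards [this] with n hn
      refine (spectrum.subset_closedBall_norm_mul _).trans (Metric.closedBall_subset_closedBall ?_)
      gcongr
    · exact Filter.Eventually.of_forall fun n => isSelfAdjoint_adjoint_mul_self _
    · refine (spectrum.subset_closedBall_norm_mul _).trans (Metric.closedBall_subset_closedBall ?_)
      gcongr
      linarith
    · exact isSelfAdjoint_adjoint_mul_self _
  rw [trAbsPow, ENNReal.tsum_eq_iSup_sum]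
  refine iSup_le fun s => ?_
  have hlim : Filter.Tendsto
      (fun n => ∑ i ∈ s, ENNReal.ofReal (⟪b i, (absPow (T n) q) (b i)⟫_ℂ).re) Filter.atTop
      (nhds (∑ i ∈ s, ENNReal.ofReal (⟪b i, (absPow T₀ q) (b i)⟫_ℂ).re)) := by
    refine tendsto_finsetSum _ fun i _ => ENNReal.tendsto_ofReal ?_
    have hc : Continuous fun R : H →L[ℂ] H => (⟪b i, R (b i)⟫_ℂ).re :=
      Complex.continuous_re.comp (by fun_prop)
    exact (hc.tendsto _).comp habs
  exact le_of_tendsto' hlim fun n => (ENNReal.sum_le_tsum s).trans (hS n)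

end

/-- The finite-rank operator with singular values `σ` and singular vectors `u`, `v`. -/
def finiteSVD {n : ℕ} (σ : Fin n → ℝ) (v u : Fin n → H) : H →L[ℂ] H :=
  ∑ j, (σ j : ℂ) • InnerProductSpace.rankOne ℂ (v j) (u j)

lemma finiteSVD_apply {n : ℕ} (σ : Fin n → ℝ) (v u : Fin n → H) (x : H) :
    finiteSVD σ v u x = ∑ j, ((σ j : ℂ) * ⟪u j, x⟫_ℂ) • v j := by
  simp [finiteSVD, mul_smul]

lemma adjoint_mul_finiteSVD {n : ℕ} (σ : Fin n → ℝ) {v u : Fin n → H}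
    (hv : Orthonormal ℂ v) (x : H) :
    (ContinuousLinearMap.adjoint (finiteSVD σ v u) * finiteSVD σ v u) x =
      ∑ j, ((σ j : ℂ) ^ 2 * ⟪u j, x⟫_ℂ) • u j := by
  classical
  refine ext_inner_left ℂ fun y => ?_
  rw [mul_apply_eq_comp, ContinuousLinearMap.adjoint_inner_right, finiteSVD_apply,
    finiteSVD_apply, hv.inner_sum]
  simp only [inner_sum, inner_smul_right, map_mul, Complex.conj_ofReal, inner_conj_symm]
  exact Finset.sum_congr rfl fun j _ => by ring

lemma absPow_finiteSVD {n : ℕ} {σ : Fin n → ℝ} (hσ : ∀ j, 0 ≤ σ j) {v u : Fin n → H}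
    (hv : Orthonormal ℂ v) (hu : Orthonormal ℂ u) {q : ℝ} (hq : 0 < q) (x : H) :
    absPow (finiteSVD σ v u) q x = ∑ j, (((σ j ^ q : ℝ) : ℂ) * ⟪u j, x⟫_ℂ) • u j := by
  classical
  have hcont : Continuous fun x : ℝ => x ^ (q / 2) := Real.continuous_rpow_const (by positivity)
  have hsa := isSelfAdjoint_adjoint_mul_self (finiteSVD σ v u)
  have hu' : ∀ j, absPow (finiteSVD σ v u) q (u j) = ((σ j ^ q : ℝ) : ℂ) • u j := by
    intro j
    have h := cfc_apply_eigenvector hsa hcont (u := u j) (t := σ j ^ 2) (by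
      rw [adjoint_mul_finiteSVD σ hv]
      simp [orthonormal_iff_ite.1 hu])
    rw [absPow, h, ← Real.rpow_natCast, ← Real.rpow_mul (hσ j)]
    congr 4
    push_cast
    ring
  set y := x - ∑ j, ⟪u j, x⟫_ℂ • u j with hy
  have hy0 : ∀ j, ⟪u j, y⟫_ℂ = 0 := by
    intro j
    rw [hy, inner_sub_right, hu.inner_right_fintype, sub_self]
  have hyT : absPow (finiteSVD σ v u) q y = 0 := by
    have h := cfc_apply_eigenvector hsa hcont (u := y) (t := 0) (by
      rw [adjoint_mul_finiteSVD σ hv]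
      simp [hy0])
    rw [absPow, h, Real.zero_rpow (by positivity)]
    simp
  have hx : x = y + ∑ j, ⟪u j, x⟫_ℂ • u j := by rw [hy]; abel
  conv_lhs => rw [hx]
  rw [map_add, hyT, zero_add, map_sum]
  refine Finset.sum_congr rfl fun j _ => ?_
  rw [map_smul, hu', smul_smul, mul_comm]

lemma trAbsPow_finiteSVD {ι : Type*} (b : HilbertBasis ι ℂ H) {n : ℕ} {σ : Fin n → ℝ}
    (hσ : ∀ j, 0 ≤ σ j) {v u : Fin n → H} (hv : Orthonormal ℂ v) (hu : Orthonormal ℂ u)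
    {q : ℝ} (hq : 0 < q) :
    trAbsPow b (finiteSVD σ v u) q = ENNReal.ofReal (∑ j, σ j ^ q) := by
  have hdiag : ∀ i, (⟪b i, absPow (finiteSVD σ v u) q (b i)⟫_ℂ).re =
      ∑ j, σ j ^ q * ‖⟪b i, u j⟫_ℂ‖ ^ 2 := by
    intro i
    rw [absPow_finiteSVD hσ hv hu hq, inner_sum, Complex.re_sum]
    refine Finset.sum_congr rfl fun j _ => ?_
    rw [inner_smul_right, mul_assoc, ← inner_conj_symm (u j) (b i), mul_comm (starRingEnd ℂ _),
      Complex.mul_conj, Complex.normSq_eq_norm_sq]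
    norm_cast
  have hpow : ∀ j, 0 ≤ σ j ^ q := fun j => Real.rpow_nonneg (hσ j) q
  simp_rw [trAbsPow, hdiag]
  calc ∑' i, ENNReal.ofReal (∑ j, σ j ^ q * ‖⟪b i, u j⟫_ℂ‖ ^ 2)
      = ∑' i, ∑ j, ENNReal.ofReal (σ j ^ q) * ENNReal.ofReal (‖⟪b i, u j⟫_ℂ‖ ^ 2) := by
        refine tsum_congr fun i => ?_
        rw [ENNReal.ofReal_sum_of_nonneg fun j _ => mul_nonneg (hpow j) (by positivity)]
        exact Finset.sum_congr rfl fun j _ => ENNReal.ofReal_mul (hpow j)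
    _ = ∑ j, ENNReal.ofReal (σ j ^ q) := by
        rw [Summable.tsum_finsetSum fun _ _ => ENNReal.summable]
        refine Finset.sum_congr rfl fun j _ => ?_
        rw [ENNReal.tsum_mul_left, b.tsum_ofReal_norm_inner_sq, hu.1 j]
        simp
    _ = _ := (ENNReal.ofReal_sum_of_nonneg fun j _ => hpow j).symm

lemma inner_self_eq_ofReal_norm_sq (x : H) : ⟪x, x⟫_ℂ = ((‖x‖ ^ 2 : ℝ) : ℂ) := by
  rw [inner_self_eq_norm_sq_to_K, Complex.ofReal_pow]
  rfl

/-- A subspace on which a positive operator of finite trace is bounded below is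
finite-dimensional. -/
lemma finiteDimensional_of_tsum_ne_top {ι : Type*} (b : HilbertBasis ι ℂ H) {P : H →L[ℂ] H}
    (hP : P.IsPositive) (htr : ∑' i, ENNReal.ofReal (⟪b i, P (b i)⟫_ℂ).re ≠ ∞)
    {L : Submodule ℂ H} {c : ℝ} (hc : 0 < c)
    (hL : ∀ y ∈ L, c * ‖y‖ ^ 2 ≤ (⟪y, P y⟫_ℂ).re) : FiniteDimensional ℂ L := by
  by_contra hfin
  have hrank : Cardinal.aleph0 ≤ Module.rank ℂ L :=
    not_lt.1 fun h => hfin (Module.rank_lt_aleph0_iff.1 h)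
  obtain ⟨m, hm⟩ := exists_nat_gt ((∑' i, ENNReal.ofReal (⟪b i, P (b i)⟫_ℂ).re).toReal / c)
  obtain ⟨f, hf⟩ := exists_linearIndependent_of_le_rank (n := m) (R := ℂ) (M := L)
    (Cardinal.natCast_le_aleph0.trans hrank)
  obtain ⟨g, hg⟩ : ∃ g : Fin m → L, Orthonormal ℂ g :=
    ⟨_, InnerProductSpace.gramSchmidtNormed_orthonormal hf⟩
  have hw : Orthonormal ℂ fun j => (g j : H) := hg.comp_linearIsometry L.subtypeₗᵢ
  have h1 := hw.sum_ofReal_inner_le_tsum b hP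
  have h2 : ∑ _j : Fin m, ENNReal.ofReal c ≤
      ∑ j, ENNReal.ofReal (⟪(g j : H), P (g j : H)⟫_ℂ).re := by
    refine Finset.sum_le_sum fun j _ => ENNReal.ofReal_le_ofReal ?_
    have h := hL _ (g j).2
    rwa [hw.1 j, one_pow, mul_one] at h
  have h3 := ENNReal.toReal_mono htr (h2.trans h1)
  rw [Finset.sum_const, Finset.card_univ, Fintype.card_fin, nsmul_eq_mul, ENNReal.toReal_mul,
    ENNReal.toReal_ofReal hc.le, ENNReal.toReal_natCast] at h3
  rw [div_lt_iff₀ hc] at hm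
  linarith

/-- An operator of a Schatten class is, up to a small error in operator norm, given by finitely
many of its singular values. -/
lemma exists_finiteSVD_approx {ι : Type*} (b : HilbertBasis ι ℂ H) (T : H →L[ℂ] H) {q : ℝ}
    (hq : 0 < q) (hT : trAbsPow b T q ≠ ∞) {ε : ℝ} (hε : 0 < ε) :
    ∃ (n : ℕ) (σ : Fin n → ℝ) (v u : Fin n → H), (∀ j, 0 < σ j) ∧ Orthonormal ℂ v ∧
      Orthonormal ℂ u ∧ (∀ j, T (u j) = (σ j : ℂ) • v j) ∧ ‖T - finiteSVD σ v u‖ ≤ ε ∧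
      ENNReal.ofReal (∑ j, σ j ^ q) ≤ trAbsPow b T q := by
  set A := ContinuousLinearMap.adjoint T * T with hAdef
  have hA : IsSelfAdjoint A := isSelfAdjoint_adjoint_mul_self T
  have hAinner : ∀ x y, ⟪x, A y⟫_ℂ = ⟪T x, T y⟫_ℂ := fun x y => by
    rw [hAdef, mul_apply_eq_comp, ContinuousLinearMap.adjoint_inner_right]
  have hcont : Continuous fun x : ℝ => x ^ (q / 2) := Real.continuous_rpow_const (by positivity)
  set δ := ε ^ 2 with hδ
  have hδ0 : 0 < δ := by positivity
  set g : ℝ → ℝ := fun x => max 0 (x - δ) with hg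
  have hgc : Continuous g := by fun_prop
  set G := cfc g A with hG
  have hGsa : IsSelfAdjoint G := cfc_predicate g A
  have hGsymm : ∀ x y, ⟪G x, y⟫_ℂ = ⟪x, G y⟫_ℂ := hGsa.isSymmetric
  set L : Submodule ℂ H := LinearMap.range (G : H →ₗ[ℂ] H) with hL
  set c := δ ^ (q / 2) with hc
  have hc0 : 0 < c := Real.rpow_pos_of_pos hδ0 _
  have hlow : ∀ y ∈ L, c * ‖y‖ ^ 2 ≤ (⟪y, absPow T q y⟫_ℂ).re := by
    rintro _ ⟨z, rfl⟩
    change c * ‖G z‖ ^ 2 ≤ (⟪G z, absPow T q (G z)⟫_ℂ).re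
    have hpos := re_inner_cfc_nonneg A (f := fun x => g x * ((x ^ (q / 2) - c) * g x)) (by
      intro x _
      by_cases hx : x ≤ δ
      · have : g x = 0 := by simp [hg, hx]
        simp [this]
      · have h1 : c ≤ x ^ (q / 2) :=
          Real.rpow_le_rpow hδ0.le (not_le.1 hx).le (by positivity)
        have h2 : 0 ≤ g x := le_max_left _ _
        have h3 : 0 ≤ x ^ (q / 2) - c := by linarith
        positivity) z
    rw [cfc_mul g (fun x => (x ^ (q / 2) - c) * g x) A hgc.continuousOn
        ((hcont.sub continuous_const).mul hgc).continuousOn,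
      cfc_mul (fun x => x ^ (q / 2) - c) g A (hcont.sub continuous_const).continuousOn
        hgc.continuousOn,
      cfc_sub (fun x => x ^ (q / 2)) (fun _ => c) A hcont.continuousOn continuousOn_const,
      cfc_const c A, ← hG, mul_apply_eq_comp, ← hGsymm, mul_apply_eq_comp, sub_apply,
      inner_sub_right, Complex.sub_re] at hpos
    have h4 : (⟪G z, (algebraMap ℝ (H →L[ℂ] H) c) (G z)⟫_ℂ).re = c * ‖G z‖ ^ 2 := by
      have : (algebraMap ℝ (H →L[ℂ] H) c) (G z) = (c : ℂ) • G z := by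
        simp [Algebra.algebraMap_eq_smul_one]
      rw [this, inner_smul_right, inner_self_eq_ofReal_norm_sq, Complex.re_ofReal_mul,
        Complex.ofReal_re]
    rw [h4] at hpos
    exact sub_nonneg.1 hpos
  have hfin : FiniteDimensional ℂ L :=
    finiteDimensional_of_tsum_ne_top b (absPow_isPositive T q) hT hc0 hlow
  have hcomm : ∀ x, A (G x) = G (A x) := by
    intro x
    have h := (cfc_commute_cfc (fun x : ℝ => x) g A).eq
    rw [cfc_id' ℝ A] at h
    exact DFunLike.congr_fun h x
  have hinv : ∀ y ∈ L, (A : H →ₗ[ℂ] H) y ∈ L := by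
    rintro _ ⟨z, rfl⟩
    exact ⟨A z, (hcomm z).symm⟩
  have hsymm : ((A : H →ₗ[ℂ] H).restrict hinv).IsSymmetric :=
    LinearMap.IsSymmetric.restrict_invariant hA.isSymmetric hinv
  set w := hsymm.eigenvectorBasis rfl with hw
  set τ := hsymm.eigenvalues rfl with hτ
  set u : Fin (Module.finrank ℂ L) → H := fun j => (w j : H) with hu
  have hortho : Orthonormal ℂ u := w.orthonormal.comp_linearIsometry L.subtypeₗᵢ
  have hAu : ∀ j, A (u j) = (τ j : ℂ) • u j := fun j =>
    congrArg Subtype.val (hsymm.apply_eigenvectorBasis rfl j)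
  have habs : ∀ j, absPow T q (u j) = ((τ j ^ (q / 2) : ℝ) : ℂ) • u j := fun j =>
    cfc_apply_eigenvector hA hcont (hAu j)
  have hTu : ∀ i j, ⟪T (u i), T (u j)⟫_ℂ = (τ j : ℂ) * ⟪u i, u j⟫_ℂ := fun i j => by
    rw [← hAinner, hAu, inner_smul_right]
  have huu : ∀ j, ⟪u j, u j⟫_ℂ = 1 := fun j => by
    rw [inner_self_eq_ofReal_norm_sq, hortho.1 j]
    simp
  have hτnorm : ∀ j, τ j = ‖T (u j)‖ ^ 2 := fun j => by
    have h := hTu j j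
    rw [huu, mul_one, inner_self_eq_ofReal_norm_sq] at h
    exact (Complex.ofReal_injective h).symm
  have hτ0 : ∀ j, 0 < τ j := by
    intro j
    have h0 : 0 ≤ τ j := by rw [hτnorm]; positivity
    refine h0.lt_of_ne fun h => ?_
    have h1 := hlow (u j) (w j).2
    rw [habs, ← h, Real.zero_rpow (by positivity), hortho.1 j] at h1
    simp at h1
    linarith
  set σ : Fin (Module.finrank ℂ L) → ℝ := fun j => √(τ j) with hσ
  have hσ0 : ∀ j, 0 < σ j := fun j => Real.sqrt_pos.2 (hτ0 j)
  have hσC : ∀ j, (σ j : ℂ) ≠ 0 := fun j => by exact_mod_cast (hσ0 j).ne'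
  have hσq : ∀ j, σ j ^ q = τ j ^ (q / 2) := fun j => by
    rw [hσ]
    dsimp only
    rw [Real.sqrt_eq_rpow, ← Real.rpow_mul (hτ0 j).le]
    congr 1
    ring
  set v : Fin (Module.finrank ℂ L) → H := fun j => (σ j : ℂ)⁻¹ • T (u j) with hv
  have hTv : ∀ j, T (u j) = (σ j : ℂ) • v j := fun j => (smul_inv_smul₀ (hσC j) _).symm
  have hvo : Orthonormal ℂ v := by
    refine ⟨fun j => ?_, fun i j hij => ?_⟩
    · have : ‖T (u j)‖ = σ j := by
        rw [hσ]
        dsimp only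
        rw [hτnorm, Real.sqrt_sq (norm_nonneg _)]
      rw [hv]
      dsimp only
      rw [norm_smul, this, norm_inv, Complex.norm_real, Real.norm_of_nonneg (hσ0 j).le,
        inv_mul_cancel₀ (hσ0 j).ne']
    · rw [hv]
      dsimp only
      rw [inner_smul_left, inner_smul_right, hTu, hortho.2 hij]
      simp
  refine ⟨_, σ, v, u, hσ0, hvo, hortho, hTv, ?_, ?_⟩
  · refine ContinuousLinearMap.opNorm_le_bound _ hε.le fun x => ?_
    set y := x - ∑ j, ⟪u j, x⟫_ℂ • u j with hy
    have hTy : (T - finiteSVD σ v u) x = T y := by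
      rw [sub_apply, finiteSVD_apply, hy, map_sub, map_sum]
      congr 1
      refine Finset.sum_congr rfl fun j _ => ?_
      rw [map_smul, mul_comm, mul_smul, ← hTv j]
    have hyu : ∀ j, ⟪u j, y⟫_ℂ = 0 := fun j => by
      rw [hy, inner_sub_right, hortho.inner_right_fintype, sub_self]
    have hyx : ‖y‖ ≤ ‖x‖ := by
      have hxy : x = y + ∑ j, ⟪u j, x⟫_ℂ • u j := by rw [hy]; abel
      have h0 : ⟪y, ∑ j, ⟪u j, x⟫_ℂ • u j⟫_ℂ = 0 := by
        rw [inner_sum]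
        refine Finset.sum_eq_zero fun j _ => ?_
        rw [inner_smul_right, ← inner_conj_symm y (u j), hyu]
        simp
      have h1 := norm_add_sq_eq_norm_sq_add_norm_sq_of_inner_eq_zero _ _ h0
      rw [← hxy] at h1
      nlinarith [norm_nonneg x, norm_nonneg y, mul_self_nonneg ‖∑ j, ⟪u j, x⟫_ℂ • u j‖]
    have hGy : G y = 0 := by
      rw [← inner_self_eq_zero (𝕜 := ℂ), ← hGsymm]
      have hmem : G (G y) ∈ L := ⟨G y, rfl⟩
      have hexp : (G (G y) : H) = ∑ j, ⟪u j, G (G y)⟫_ℂ • u j := by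
        have h := congrArg Subtype.val (w.sum_repr' ⟨G (G y), hmem⟩)
        simpa using h.symm
      rw [hexp, sum_inner]
      refine Finset.sum_eq_zero fun j _ => ?_
      rw [inner_smul_left, hyu, mul_zero]
    have hpos := re_inner_cfc_nonneg A (f := fun x => g x - (x - δ)) (by
      intro x _
      exact sub_nonneg.2 (le_max_right _ _)) y
    rw [cfc_sub g (fun x => x - δ) A hgc.continuousOn (by fun_prop),
      cfc_sub (fun x => x) (fun _ => δ) A continuousOn_id continuousOn_const,
      cfc_const δ A, cfc_id' ℝ A, ← hG, sub_apply, sub_apply, hGy, zero_sub, inner_neg_right,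
      inner_sub_right, hAinner] at hpos
    have h4 : (algebraMap ℝ (H →L[ℂ] H) δ) y = (δ : ℂ) • y := by
      simp [Algebra.algebraMap_eq_smul_one]
    rw [h4, inner_smul_right, inner_self_eq_ofReal_norm_sq, inner_self_eq_ofReal_norm_sq,
      Complex.neg_re, Complex.sub_re, Complex.re_ofReal_mul, Complex.ofReal_re,
      Complex.ofReal_re] at hpos
    have h5 : ‖T y‖ ^ 2 ≤ δ * ‖y‖ ^ 2 := by linarith
    rw [hTy]
    have h6 : ‖T y‖ ≤ ε * ‖y‖ := by
      rw [hδ, ← mul_pow] at h5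
      exact (sq_le_sq₀ (norm_nonneg _) (by positivity)).1 h5
    exact h6.trans (by gcongr)
  · rw [ENNReal.ofReal_sum_of_nonneg fun j _ => Real.rpow_nonneg (hσ0 j).le q]
    refine le_trans (Finset.sum_le_sum fun j _ => ?_)
      (hortho.sum_ofReal_inner_le_tsum b (absPow_isPositive T q))
    refine ENNReal.ofReal_le_ofReal ?_
    rw [habs, inner_smul_right, huu, mul_one, hσq, Complex.ofReal_re]

/-- The off-diagonal values of a positive sesquilinear form are dominated by the diagonal ones. -/
lemma norm_sesqForm_le_of_nonneg {E : Type*} [AddCommGroup E] [Module ℂ E]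
    (Φ : E →ₗ⋆[ℂ] E →ₗ[ℂ] ℂ) (hre : ∀ x, 0 ≤ (Φ x x).re) (him : ∀ x, (Φ x x).im = 0) (x y : E) :
    ‖Φ x y‖ ≤ ((Φ x x).re + (Φ y y).re) / 2 := by
  obtain ⟨c, hc, hcΦ⟩ := Complex.exists_norm_eq_one_mul_eq_norm (Φ x y)
  have hconj : Φ y x = starRingEnd ℂ (Φ x y) := by
    have h1 := him (x + y)
    have h2 := him (x + Complex.I • y)
    simp [him] at h1 h2
    apply Complex.ext
    · simp
      linarith
    · simp
      linarith
  have h := hre (x - c • y)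
  have hcc : starRingEnd ℂ c * c = 1 := by
    rw [mul_comm, Complex.mul_conj, Complex.normSq_eq_norm_sq, hc]
    simp
  have hexp : Φ (x - c • y) (x - c • y) =
      Φ x x - c * Φ x y - starRingEnd ℂ (c * Φ x y) + starRingEnd ℂ c * c * Φ y y := by
    simp [hconj]
    ring
  rw [hexp, hcc, hcΦ, Complex.conj_ofReal, one_mul] at h
  simp at h
  linarith

/-- The sesquilinear form `(y, x) ↦ ⟪y, T x⟫`. -/
def operatorForm (T : H →L[ℂ] H) : H →ₗ⋆[ℂ] H →ₗ[ℂ] ℂ :=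
  LinearMap.mk₂'ₛₗ (starRingEnd ℂ) (RingHom.id ℂ) (fun y x => ⟪y, T x⟫_ℂ)
    (fun _ _ _ => inner_add_left _ _ _) (fun _ _ _ => inner_smul_left _ _ _)
    (fun _ _ _ => by rw [map_add, inner_add_right])
    (fun _ _ _ => by rw [map_smul, inner_smul_right]; rfl)

/-- The sesquilinear form `(y, x) ↦ ⟪v, N(|x⟩⟨y|) u⟫`. -/
def rankOneForm (N : (H →L[ℂ] H) →L[ℂ] (H →L[ℂ] H)) (v u : H) : H →ₗ⋆[ℂ] H →ₗ[ℂ] ℂ :=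
  LinearMap.mk₂'ₛₗ (starRingEnd ℂ) (RingHom.id ℂ)
    (fun y x => ⟪v, N (InnerProductSpace.rankOne ℂ x y) u⟫_ℂ)
    (fun _ _ _ => by rw [map_add, map_add, add_apply, inner_add_right])
    (fun _ _ _ => by rw [map_smulₛₗ, map_smul, smul_apply, inner_smul_right]; rfl)
    (fun _ _ _ => by rw [map_add, add_apply, map_add, add_apply, inner_add_right])
    (fun _ _ _ => by rw [map_smul, smul_apply, map_smul, smul_apply, inner_smul_right]; rfl)

lemma im_inner_eq_zero_of_isPositive {P : H →L[ℂ] H} (hP : P.IsPositive) (x : H) :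
    (⟪x, P x⟫_ℂ).im = 0 :=
  (Complex.nonneg_iff.1 (hP.inner_nonneg_right x)).2.symm

lemma norm_inner_le_of_isPositive {P : H →L[ℂ] H} (hP : P.IsPositive) (v u : H) :
    ‖⟪v, P u⟫_ℂ‖ ≤ ((⟪v, P v⟫_ℂ).re + (⟪u, P u⟫_ℂ).re) / 2 :=
  norm_sesqForm_le_of_nonneg (operatorForm P) hP.re_inner_nonneg_right
    (im_inner_eq_zero_of_isPositive hP) v u

lemma re_inner_le_norm_of_norm_eq_one (T : H →L[ℂ] H) {u : H} (hu : ‖u‖ = 1) :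
    (⟪u, T u⟫_ℂ).re ≤ ‖T‖ := by
  refine (Complex.re_le_norm _).trans ((norm_inner_le_norm _ _).trans ?_)
  simpa [hu] using T.le_opNorm u

lemma norm_inner_map_rankOne_le {N : (H →L[ℂ] H) →L[ℂ] (H →L[ℂ] H)}
    (hpos : ∀ T : H →L[ℂ] H, T.IsPositive → (N T).IsPositive)
    (w f e : H) :
    ‖⟪w, N (InnerProductSpace.rankOne ℂ f e) w⟫_ℂ‖ ≤
      ((⟪w, N (InnerProductSpace.rankOne ℂ e e) w⟫_ℂ).re +
        (⟪w, N (InnerProductSpace.rankOne ℂ f f) w⟫_ℂ).re) / 2 :=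
  norm_sesqForm_le_of_nonneg (rankOneForm N w w)
    (fun x => (hpos _ (InnerProductSpace.isPositive_rankOne_self x)).re_inner_nonneg_right w)
    (fun x => im_inner_eq_zero_of_isPositive
      (hpos _ (InnerProductSpace.isPositive_rankOne_self x)) w) e f

lemma sum_re_inner_map_rankOne_self_le {N : (H →L[ℂ] H) →L[ℂ] (H →L[ℂ] H)}
    (hpos : ∀ T : H →L[ℂ] H, T.IsPositive → (N T).IsPositive)
    {m : ℕ} {w : Fin m → H} (hw : Orthonormal ℂ w) {u : H}
    (hu : ‖u‖ = 1) :
    ∑ l, (⟪u, N (InnerProductSpace.rankOne ℂ (w l) (w l)) u⟫_ℂ).re ≤ ‖N 1‖ := by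
  have hP : (1 - ∑ l, InnerProductSpace.rankOne ℂ (w l) (w l) : H →L[ℂ] H).IsPositive := by
    rw [ContinuousLinearMap.isPositive_iff_complex]
    intro x
    have h : ⟪(1 - ∑ l, InnerProductSpace.rankOne ℂ (w l) (w l) : H →L[ℂ] H) x, x⟫_ℂ =
        ((‖x‖ ^ 2 - ∑ l, ‖⟪w l, x⟫_ℂ‖ ^ 2 : ℝ) : ℂ) := by
      rw [sub_apply, inner_sub_left, one_apply_eq_self, inner_self_eq_ofReal_norm_sq,
        sum_apply, sum_inner, Complex.ofReal_sub, Complex.ofReal_sum]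
      congr 1
      refine Finset.sum_congr rfl fun l _ => ?_
      rw [InnerProductSpace.rankOne_apply, inner_smul_left, mul_comm, Complex.mul_conj,
        Complex.normSq_eq_norm_sq]
    rw [h]
    exact ⟨rfl, sub_nonneg.2 (hw.sum_inner_products_le x)⟩
  have h := (hpos _ hP).re_inner_nonneg_right u
  rw [map_sub, map_sum, sub_apply, sum_apply, inner_sub_right, inner_sum, map_sub, map_sum] at h
  exact (sub_nonneg.1 h).trans (re_inner_le_norm_of_norm_eq_one _ hu)

/-- Row sums of the matrix of a positive map between orthonormal systems. -/
lemma sum_norm_inner_map_rankOne_le_norm_one {N : (H →L[ℂ] H) →L[ℂ] (H →L[ℂ] H)}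
    (hpos : ∀ T : H →L[ℂ] H, T.IsPositive → (N T).IsPositive)
    {n : ℕ} {f e : Fin n → H} (hf : Orthonormal ℂ f)
    (he : Orthonormal ℂ e) {v u : H} (hv : ‖v‖ = 1) (hu : ‖u‖ = 1) :
    ∑ k, ‖⟪v, N (InnerProductSpace.rankOne ℂ (f k) (e k)) u⟫_ℂ‖ ≤ ‖N 1‖ := by
  refine Orthonormal.sum_norm_sesqForm_le (rankOneForm N v u) (fun m w hw => ?_) he hf
  have h1 := sum_re_inner_map_rankOne_self_le hpos hw hv
  have h2 := sum_re_inner_map_rankOne_self_le hpos hw hu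
  calc ∑ l, ‖rankOneForm N v u (w l) (w l)‖
      ≤ ∑ l, ((⟪v, N (InnerProductSpace.rankOne ℂ (w l) (w l)) v⟫_ℂ).re +
          (⟪u, N (InnerProductSpace.rankOne ℂ (w l) (w l)) u⟫_ℂ).re) / 2 :=
        Finset.sum_le_sum fun l _ => norm_inner_le_of_isPositive
          (hpos _ (InnerProductSpace.isPositive_rankOne_self (w l))) v u
    _ ≤ ‖N 1‖ := by
        rw [← Finset.sum_div, Finset.sum_add_distrib]
        linarith

/-- Column sums of the matrix of a positive map between orthonormal systems. -/
lemma sum_norm_inner_map_rankOne_le {N : (H →L[ℂ] H) →L[ℂ] (H →L[ℂ] H)}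
    (hpos : ∀ T : H →L[ℂ] H, T.IsPositive → (N T).IsPositive)
    {M : ℝ}
    (hM : ∀ (x : H), ‖x‖ = 1 → ∀ (m : ℕ) (w : Fin m → H), Orthonormal ℂ w →
      ∑ l, (⟪w l, N (InnerProductSpace.rankOne ℂ x x) (w l)⟫_ℂ).re ≤ M)
    {n : ℕ} {v u : Fin n → H} (hv : Orthonormal ℂ v)
    (hu : Orthonormal ℂ u) {f e : H} (hf : ‖f‖ = 1) (he : ‖e‖ = 1) :
    ∑ j, ‖⟪v j, N (InnerProductSpace.rankOne ℂ f e) (u j)⟫_ℂ‖ ≤ M := by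
  refine Orthonormal.sum_norm_sesqForm_le (operatorForm (N (InnerProductSpace.rankOne ℂ f e)))
    (fun m w hw => ?_) hv hu
  have h1 := hM e he m w hw
  have h2 := hM f hf m w hw
  calc ∑ l, ‖operatorForm (N (InnerProductSpace.rankOne ℂ f e)) (w l) (w l)‖
      ≤ ∑ l, ((⟪w l, N (InnerProductSpace.rankOne ℂ e e) (w l)⟫_ℂ).re +
          (⟪w l, N (InnerProductSpace.rankOne ℂ f f) (w l)⟫_ℂ).re) / 2 :=
        Finset.sum_le_sum fun l _ => norm_inner_map_rankOne_le hpos (w l) f e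
    _ ≤ M := by
        rw [← Finset.sum_div, Finset.sum_add_distrib]
        linarith

lemma absPow_one_of_isPositive {P : H →L[ℂ] H} (hP : P.IsPositive) : absPow P 1 = P := by
  have hP0 : 0 ≤ P := (ContinuousLinearMap.nonneg_iff_isPositive _).2 hP
  have hsa : IsSelfAdjoint P := hP0.isSelfAdjoint
  have hadj : ContinuousLinearMap.adjoint P = P := hsa
  have hcont : Continuous fun x : ℝ => x ^ ((1 : ℝ) / 2) :=
    Real.continuous_rpow_const (by positivity)
  rw [absPow, hadj, ← sq, ← cfc_comp_pow _ 2 P hcont.continuousOn hsa]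
  conv_rhs => rw [← cfc_id' ℝ P hsa]
  refine cfc_congr fun x hx => ?_
  have hx0 : 0 ≤ x := spectrum_nonneg_of_nonneg hP0 hx
  rw [← Real.sqrt_eq_rpow, Real.sqrt_sq hx0]

lemma sum_re_inner_map_rankOne_self_le_norm_dual {ι : Type*} (b : HilbertBasis ι ℂ H)
    {N : (H →L[ℂ] H) →L[ℂ] (H →L[ℂ] H)}
    (hpos : ∀ T : H →L[ℂ] H, T.IsPositive → (N T).IsPositive)
    {C : ℝ≥0∞} (hC : C ≠ ∞)
    (hbound : ∀ T : H →L[ℂ] H, trAbsPow b (N T) 1 ≤ C * trAbsPow b T 1)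
    {N' : (H →L[ℂ] H) →L[ℂ] (H →L[ℂ] H)}
    (hdual : ∀ X Y : H →L[ℂ] H, trAbsPow b X 1 ≠ ∞ →
      traceC b (N' Y * X) = traceC b (Y * N X))
    {x : H} (hx : ‖x‖ = 1) {m : ℕ} {w : Fin m → H} (hw : Orthonormal ℂ w) :
    ∑ l, (⟪w l, N (InnerProductSpace.rankOne ℂ x x) (w l)⟫_ℂ).re ≤ ‖N' 1‖ := by
  set R := InnerProductSpace.rankOne ℂ x x with hR
  have hRfin : trAbsPow b R 1 ≠ ∞ := by
    have hx' : Orthonormal ℂ fun _ : Fin 1 => x :=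
      ⟨fun _ => hx, fun i j hij => absurd (Subsingleton.elim i j) hij⟩
    have h := trAbsPow_finiteSVD b (σ := fun _ : Fin 1 => 1) (fun _ => zero_le_one) hx' hx'
      one_pos
    have hS : finiteSVD (fun _ : Fin 1 => 1) (fun _ => x) (fun _ => x) = R := by
      simp [finiteSVD, hR]
    rw [hS] at h
    rw [h]
    exact ENNReal.ofReal_ne_top
  have hP : (N R).IsPositive := hpos _ (InnerProductSpace.isPositive_rankOne_self x)
  set P := N R with hPdef
  have hfin : ∑' i, ENNReal.ofReal (⟪b i, P (b i)⟫_ℂ).re ≠ ∞ := by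
    have h : trAbsPow b P 1 ≠ ∞ :=
      ((hbound R).trans_lt (ENNReal.mul_lt_top hC.lt_top hRfin.lt_top)).ne
    rwa [trAbsPow, absPow_one_of_isPositive hP] at h
  have hnn : ∀ y, 0 ≤ (⟪y, P y⟫_ℂ).re := hP.re_inner_nonneg_right
  have hsum : Summable fun i => (⟪b i, P (b i)⟫_ℂ).re := by
    have h := ENNReal.summable_toReal hfin
    simpa only [ENNReal.toReal_ofReal (hnn _)] using h
  have htr : traceC b P = ((∑' i, (⟪b i, P (b i)⟫_ℂ).re : ℝ) : ℂ) := by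
    rw [traceC, Complex.ofReal_tsum]
    refine tsum_congr fun i => Complex.ext rfl ?_
    rw [im_inner_eq_zero_of_isPositive hP, Complex.ofReal_im]
  have hdualR : ⟪x, N' 1 x⟫_ℂ = traceC b P := by
    have h := hdual R 1 hRfin
    rw [one_mul] at h
    rw [← h, traceC, ← b.tsum_inner_mul_inner]
    refine tsum_congr fun i => ?_
    rw [mul_apply_eq_comp, hR, InnerProductSpace.rankOne_apply, map_smul, inner_smul_right]
  have hle := hw.sum_ofReal_inner_le_tsum b hP
  rw [← ENNReal.ofReal_sum_of_nonneg fun l _ => hnn (w l),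
    ← ENNReal.ofReal_tsum_of_nonneg (fun i => hnn (b i)) hsum,
    ENNReal.ofReal_le_ofReal_iff (tsum_nonneg fun i => hnn (b i))] at hle
  refine hle.trans ?_
  rw [← Complex.ofReal_re (∑' i, _), ← htr, ← hdualR]
  exact re_inner_le_norm_of_norm_eq_one _ hx

/-- Schur test for the singular values of the image of a finite-rank operator. -/
lemma sum_singularValues_rpow_le {N : (H →L[ℂ] H) →L[ℂ] (H →L[ℂ] H)}
    (hpos : ∀ T : H →L[ℂ] H, T.IsPositive → (N T).IsPositive)
    {M : ℝ}
    (hM : ∀ (x : H), ‖x‖ = 1 → ∀ (m : ℕ) (w : Fin m → H), Orthonormal ℂ w →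
      ∑ l, (⟪w l, N (InnerProductSpace.rankOne ℂ x x) (w l)⟫_ℂ).re ≤ M)
    {p : ℝ} (hp : 1 < p) {n : ℕ} {s : Fin n → ℝ} (hs : ∀ k, 0 ≤ s k) {f e : Fin n → H}
    (hf : Orthonormal ℂ f) (he : Orthonormal ℂ e) {m : ℕ} {σ : Fin m → ℝ} (hσ : ∀ j, 0 ≤ σ j)
    {v u : Fin m → H} (hv : Orthonormal ℂ v) (hu : Orthonormal ℂ u)
    (hN : ∀ j, N (finiteSVD s f e) (u j) = (σ j : ℂ) • v j) :
    ∑ j, σ j ^ p ≤ ‖N 1‖ ^ (p - 1) * M * ∑ k, s k ^ p := by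
  have hp0 : 0 < p := by linarith
  set a : Fin m → Fin n → ℝ :=
    fun j k => ‖⟪v j, N (InnerProductSpace.rankOne ℂ (f k) (e k)) (u j)⟫_ℂ‖
  have ha0 : ∀ j k, 0 ≤ a j k := fun j k => norm_nonneg _
  have hrow : ∀ j, ∑ k, a j k ≤ ‖N 1‖ := fun j =>
    sum_norm_inner_map_rankOne_le_norm_one hpos hf he (hv.1 j) (hu.1 j)
  have hcol : ∀ k, ∑ j, a j k ≤ M := fun k =>
    sum_norm_inner_map_rankOne_le hpos hM hv hu (hf.1 k) (he.1 k)
  have hsp : ∀ k, 0 ≤ s k ^ p := fun k => Real.rpow_nonneg (hs k) p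
  have hσa : ∀ j, σ j ≤ ∑ k, a j k * s k := by
    intro j
    have h : ⟪v j, N (finiteSVD s f e) (u j)⟫_ℂ = σ j := by
      rw [hN, inner_smul_right, inner_self_eq_ofReal_norm_sq, hv.1 j]
      simp
    calc σ j = ‖⟪v j, N (finiteSVD s f e) (u j)⟫_ℂ‖ := by
          rw [h, Complex.norm_real, Real.norm_of_nonneg (hσ j)]
      _ ≤ ∑ k, a j k * s k := by
          rw [finiteSVD, map_sum, sum_apply, inner_sum]
          refine (norm_sum_le _ _).trans_eq (Finset.sum_congr rfl fun k _ => ?_)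
          rw [map_smul, smul_apply, inner_smul_right, norm_mul, Complex.norm_real,
            Real.norm_of_nonneg (hs k), mul_comm]
  have hσp : ∀ j, σ j ^ p ≤ ‖N 1‖ ^ (p - 1) * ∑ k, a j k * s k ^ p := by
    intro j
    have hsum0 : 0 ≤ ∑ k, a j k * s k ^ p :=
      Finset.sum_nonneg fun k _ => mul_nonneg (ha0 j k) (hsp k)
    have hrow0 : 0 ≤ ∑ k, a j k := Finset.sum_nonneg fun k _ => ha0 j k
    calc σ j ^ p
        ≤ ((∑ k, a j k) ^ (1 - p⁻¹) * (∑ k, a j k * s k ^ p) ^ p⁻¹) ^ p :=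
          Real.rpow_le_rpow (hσ j) ((hσa j).trans
            (Real.inner_le_weight_mul_Lp_of_nonneg _ hp.le (a j) s (ha0 j) hs)) hp0.le
      _ = (∑ k, a j k) ^ (p - 1) * ∑ k, a j k * s k ^ p := by
          rw [Real.mul_rpow (Real.rpow_nonneg hrow0 _) (Real.rpow_nonneg hsum0 _),
            ← Real.rpow_mul hrow0, ← Real.rpow_mul hsum0, inv_mul_cancel₀ hp0.ne', Real.rpow_one,
            sub_mul, one_mul, inv_mul_cancel₀ hp0.ne']
      _ ≤ ‖N 1‖ ^ (p - 1) * ∑ k, a j k * s k ^ p := by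
          gcongr
          exact hrow j
  calc ∑ j, σ j ^ p ≤ ∑ j, ‖N 1‖ ^ (p - 1) * ∑ k, a j k * s k ^ p :=
        Finset.sum_le_sum fun j _ => hσp j
    _ = ‖N 1‖ ^ (p - 1) * ∑ k, (∑ j, a j k) * s k ^ p := by
        rw [← Finset.mul_sum, Finset.sum_comm]
        simp_rw [Finset.sum_mul]
    _ ≤ ‖N 1‖ ^ (p - 1) * ∑ k, M * s k ^ p := by
        gcongr with k
        · exact hsp k
        · exact hcol k
    _ = ‖N 1‖ ^ (p - 1) * M * ∑ k, s k ^ p := by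
        rw [← Finset.mul_sum, mul_assoc]

/-- An operator of a Schatten class is a norm limit of finite-rank operators built from its
singular values. -/
lemma exists_seq_finiteSVD_tendsto {ι : Type*} (b : HilbertBasis ι ℂ H) (T : H →L[ℂ] H) {q : ℝ}
    (hq : 0 < q) (hT : trAbsPow b T q ≠ ∞) :
    ∃ S : ℕ → H →L[ℂ] H, Filter.Tendsto S Filter.atTop (nhds T) ∧
      ∀ i, ∃ (n : ℕ) (σ : Fin n → ℝ) (v u : Fin n → H), S i = finiteSVD σ v u ∧ (∀ j, 0 < σ j) ∧
        Orthonormal ℂ v ∧ Orthonormal ℂ u ∧ (∀ j, T (u j) = (σ j : ℂ) • v j) ∧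
        ENNReal.ofReal (∑ j, σ j ^ q) ≤ trAbsPow b T q := by
  choose n σ v u hσ hv hu hTu hε hle using fun i : ℕ =>
    exists_finiteSVD_approx b T hq hT (Nat.one_div_pos_of_nat (α := ℝ) (n := i))
  refine ⟨fun i => finiteSVD (σ i) (v i) (u i), ?_,
    fun i => ⟨n i, σ i, v i, u i, rfl, hσ i, hv i, hu i, hTu i, hle i⟩⟩
  rw [tendsto_iff_norm_sub_tendsto_zero]
  refine squeeze_zero (fun _ => norm_nonneg _) (fun i => ?_) tendsto_one_div_add_atTop_nhds_zero_nat
  rw [norm_sub_rev]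
  exact hε i

lemma trAbsPow_map_finiteSVD_le {ι : Type*} (b : HilbertBasis ι ℂ H)
    {N : (H →L[ℂ] H) →L[ℂ] (H →L[ℂ] H)}
    (hpos : ∀ T : H →L[ℂ] H, T.IsPositive → (N T).IsPositive)
    {C : ℝ≥0∞} (hC : C ≠ ∞)
    (hbound : ∀ T : H →L[ℂ] H, trAbsPow b (N T) 1 ≤ C * trAbsPow b T 1)
    {M : ℝ} (hM : ∀ (x : H), ‖x‖ = 1 → ∀ (m : ℕ) (w : Fin m → H), Orthonormal ℂ w →
      ∑ l, (⟪w l, N (InnerProductSpace.rankOne ℂ x x) (w l)⟫_ℂ).re ≤ M)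
    {p : ℝ} (hp : 1 < p) {n : ℕ} {s : Fin n → ℝ} (hs : ∀ k, 0 ≤ s k) {f e : Fin n → H}
    (hf : Orthonormal ℂ f) (he : Orthonormal ℂ e) :
    trAbsPow b (N (finiteSVD s f e)) p ≤
      ENNReal.ofReal (‖N 1‖ ^ (p - 1) * M * ∑ k, s k ^ p) := by
  have hp0 : 0 < p := by linarith
  have hfin : trAbsPow b (N (finiteSVD s f e)) 1 ≠ ∞ := by
    refine ((hbound _).trans_lt (ENNReal.mul_lt_top hC.lt_top ?_)).ne
    rw [trAbsPow_finiteSVD b hs hf he one_pos]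
    exact ENNReal.ofReal_lt_top
  obtain ⟨S, hS, hSVD⟩ := exists_seq_finiteSVD_tendsto b _ one_pos hfin
  refine trAbsPow_le_of_tendsto b hp0 hS fun i => ?_
  obtain ⟨m, σ, v, u, hSi, hσ, hv, hu, hN, -⟩ := hSVD i
  rw [hSi, trAbsPow_finiteSVD b (fun j => (hσ j).le) hv hu hp0]
  exact ENNReal.ofReal_le_ofReal
    (sum_singularValues_rpow_le hpos hM hp hs hf he (fun j => (hσ j).le) hv hu hN)

lemma trAbsPow_map_le {ι : Type*} (b : HilbertBasis ι ℂ H) {N : (H →L[ℂ] H) →L[ℂ] (H →L[ℂ] H)}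
    (hpos : ∀ T : H →L[ℂ] H, T.IsPositive → (N T).IsPositive)
    {C : ℝ≥0∞} (hC : C ≠ ∞)
    (hbound : ∀ T : H →L[ℂ] H, trAbsPow b (N T) 1 ≤ C * trAbsPow b T 1)
    {M : ℝ} (hM : ∀ (x : H), ‖x‖ = 1 → ∀ (m : ℕ) (w : Fin m → H), Orthonormal ℂ w →
      ∑ l, (⟪w l, N (InnerProductSpace.rankOne ℂ x x) (w l)⟫_ℂ).re ≤ M)
    {p : ℝ} (hp : 1 < p) (hM0 : 0 ≤ M) {X : H →L[ℂ] H} (hX : trAbsPow b X p ≠ ∞) :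
    trAbsPow b (N X) p ≤ ENNReal.ofReal (‖N 1‖ ^ (p - 1) * M) * trAbsPow b X p := by
  have hp0 : 0 < p := by linarith
  obtain ⟨S, hS, hSVD⟩ := exists_seq_finiteSVD_tendsto b X hp0 hX
  refine trAbsPow_le_of_tendsto b hp0 ((N.continuous.tendsto X).comp hS) fun i => ?_
  obtain ⟨m, s, f, e, hSi, hs, hf, he, -, hle⟩ := hSVD i
  rw [Function.comp_apply, hSi]
  refine (trAbsPow_map_finiteSVD_le b hpos hC hbound hM hp (fun j => (hs j).le) hf he).trans ?_
  rw [ENNReal.ofReal_mul (by positivity)]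
  gcongr

/-- Let `H` be a separable complex Hilbert space, and let
`N : B(H) → B(H)` be a bounded linear map which is positive (maps nonnegative
operators to nonnegative operators) and maps the trace class `S¹` into itself
boundedly; let `N'` be the dual map determined by `tr(N'(Y) X) = tr(Y N(X))` for all
`X ∈ S¹` and `Y ∈ B(H)`.  Then for any `1 < p < ∞` and any `X ∈ S^p`,
`‖N(X)‖_{S^p} ≤ ‖N(1)‖_B^{1/p'} · ‖N'(1)‖_B^{1/p} · ‖X‖_{S^p}` with `p' = p/(p−1)`. -/
theorem schatten_norm_bound_of_positive
    [TopologicalSpace.SeparableSpace H] {ι : Type*} (b : HilbertBasis ι ℂ H)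
    (N : (H →L[ℂ] H) →L[ℂ] (H →L[ℂ] H))
    (hpos : ∀ T : H →L[ℂ] H, T.IsPositive → (N T).IsPositive)
    (C : ℝ≥0∞) (hC : C ≠ ∞)
    (hbound : ∀ T : H →L[ℂ] H, trAbsPow b (N T) 1 ≤ C * trAbsPow b T 1)
    (N' : (H →L[ℂ] H) →L[ℂ] (H →L[ℂ] H))
    (hdual : ∀ X Y : H →L[ℂ] H, trAbsPow b X 1 ≠ ∞ →
      traceC b (N' Y * X) = traceC b (Y * N X))
    (p : ℝ) (hp : 1 < p)
    (X : H →L[ℂ] H) (hX : trAbsPow b X p ≠ ∞) :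
    schattenNorm b p (N X) ≤
      ENNReal.ofReal (‖N (1 : H →L[ℂ] H)‖ ^ ((p - 1) / p) *
          ‖N' (1 : H →L[ℂ] H)‖ ^ (1 / p)) *
        schattenNorm b p X := by
  have hp0 : 0 < p := by linarith
  have hM : ∀ x : H, ‖x‖ = 1 → ∀ (m : ℕ) (w : Fin m → H), Orthonormal ℂ w →
      ∑ l, (⟪w l, N (InnerProductSpace.rankOne ℂ x x) (w l)⟫_ℂ).re ≤ ‖N' 1‖ := fun _ hx _ _ hw =>
    sum_re_inner_map_rankOne_self_le_norm_dual b hpos hC hbound hdual hx hw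
  have h := trAbsPow_map_le b hpos hC hbound hM hp (norm_nonneg _) hX
  have hconst : (‖N 1‖ ^ (p - 1) * ‖N' 1‖) ^ (1 / p) =
      ‖N 1‖ ^ ((p - 1) / p) * ‖N' 1‖ ^ (1 / p) := by
    rw [Real.mul_rpow (by positivity) (by positivity), ← Real.rpow_mul (norm_nonneg _),
      mul_one_div]
  rw [schattenNorm, schattenNorm, ← hconst,
    ← ENNReal.ofReal_rpow_of_nonneg (by positivity) (by positivity),
    ← ENNReal.mul_rpow_of_nonneg _ _ (by positivity)]
  exact ENNReal.rpow_le_rpow h (by positivity)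
end
end

section
/- Let H be a separable complex Hilbert space and let N : B(H) → B(H) be a bounded linear map which is positive (i.e., maps nonnegative operators to nonnegative operators). Then for every unitary operator U on H and all vectors φ, ψ ∈ H, one has |⟨φ, N(U) ψ⟩| ≤ ⟨φ, N(1) φ⟩^{1/2} · ⟨ψ, N(1) ψ⟩^{1/2}. -/
open scoped InnerProductSpace

/-- The sum of the powers of a nontrivial `n`-th root of unity vanishes. -/
lemma sum_range_pow_eq_zero_of_pow_eq_one {w : ℂ} {n : ℕ} (hw : w ^ n = 1) (h1 : w ≠ 1) :
    ∑ k ∈ Finset.range n, w ^ k = 0 := by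
  rw [geom_sum_eq h1, hw, sub_self, zero_div]

/-- The normalized discrete Fourier transform of the powers `1, u, …, u ^ (n - 1)` of `u`. -/
noncomputable def fourierMean {A : Type*} [Ring A] [Algebra ℂ A] (ζ : ℂ) (n : ℕ) (u : A) (k : ℕ) :
    A :=
  (n : ℂ)⁻¹ • ∑ j ∈ Finset.range n, ((ζ⁻¹) ^ k) ^ j • u ^ j

lemma star_inv_of_norm_eq_one {ζ : ℂ} (h : ‖ζ‖ = 1) : star (ζ⁻¹) = ζ := by
  rw [Complex.inv_eq_conj h]
  simp

lemma mul_fourierMean {A : Type*} [Ring A] [Algebra ℂ A] {ζ : ℂ} {n : ℕ} (hn : n ≠ 0)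
    (hζ : IsPrimitiveRoot ζ n) (u : A) (k : ℕ) :
    u * fourierMean ζ n u k =
      ζ ^ k • fourierMean ζ n u k + ζ ^ k • (n : ℂ)⁻¹ • (u ^ n - 1) := by
  have hζ0 : ζ ^ k ≠ 0 := pow_ne_zero _ (hζ.ne_zero hn)
  have hlast : ((ζ⁻¹) ^ k) ^ n = 1 := by
    rw [← pow_mul, mul_comm, pow_mul, inv_pow, hζ.pow_eq_one]
    simp
  have hshift : ∑ j ∈ Finset.range n, ((ζ⁻¹) ^ k) ^ (j + 1) • u ^ (j + 1) =
      ∑ j ∈ Finset.range n, ((ζ⁻¹) ^ k) ^ j • u ^ j + (u ^ n - 1) := by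
    have h := (Finset.sum_range_succ' (fun j ↦ ((ζ⁻¹) ^ k) ^ j • u ^ j) n).symm.trans
      (Finset.sum_range_succ (fun j ↦ ((ζ⁻¹) ^ k) ^ j • u ^ j) n)
    rw [hlast, pow_zero, pow_zero, one_smul, one_smul] at h
    rw [eq_sub_of_add_eq h, add_sub_assoc]
  rw [← smul_add, fourierMean, ← smul_add, ← hshift, mul_smul_comm, Finset.mul_sum,
    smul_comm (ζ ^ k), Finset.smul_sum (r := ζ ^ k)]
  congr 1
  refine Finset.sum_congr rfl fun j _ ↦ ?_
  rw [mul_smul_comm, ← pow_succ', smul_smul, pow_succ' (ζ⁻¹ ^ k) j, ← mul_assoc, inv_pow,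
    mul_inv_cancel₀ hζ0, one_mul]

section StarAlgebra

variable {A : Type*} [Ring A] [StarRing A] [Algebra ℂ A] [StarModule ℂ A]

lemma star_fourierMean {ζ : ℂ} (h : ‖ζ‖ = 1) (n : ℕ) (u : A) (k : ℕ) :
    star (fourierMean ζ n u k) =
      (n : ℂ)⁻¹ • ∑ j ∈ Finset.range n, (ζ ^ k) ^ j • star u ^ j := by
  simp only [fourierMean, star_smul, star_sum, star_pow, star_inv_of_norm_eq_one h]
  simp

lemma sum_fourierMean_mul_star {ζ : ℂ} {n : ℕ} (hn : n ≠ 0) (hζ : IsPrimitiveRoot ζ n) {u : A}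
    (hu : u ∈ unitary A) :
    ∑ k ∈ Finset.range n, fourierMean ζ n u k * star (fourierMean ζ n u k) = 1 := by
  have hnorm : ‖ζ‖ = 1 := Complex.norm_eq_one_of_pow_eq_one hζ.pow_eq_one hn
  have hn' : (n : ℂ) ≠ 0 := Nat.cast_ne_zero.mpr hn
  have hζ0 : ζ ≠ 0 := hζ.ne_zero hn
  have hterm : ∀ k, fourierMean ζ n u k * star (fourierMean ζ n u k) =
      ((n : ℂ)⁻¹ * (n : ℂ)⁻¹) • ∑ i ∈ Finset.range n, ∑ j ∈ Finset.range n,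
        ((ζ⁻¹ ^ i * ζ ^ j) ^ k) • (u ^ i * star u ^ j) := by
    intro k
    rw [star_fourierMean hnorm, fourierMean, smul_mul_smul_comm, Finset.sum_mul_sum]
    congr 1
    refine Finset.sum_congr rfl fun i _ ↦ Finset.sum_congr rfl fun j _ ↦ ?_
    rw [smul_mul_smul_comm, mul_pow, ← pow_mul, ← pow_mul, ← pow_mul, ← pow_mul, mul_comm k i,
      mul_comm k j]
  have horth : ∀ i ∈ Finset.range n, ∀ j ∈ Finset.range n,
      ∑ k ∈ Finset.range n, (ζ⁻¹ ^ i * ζ ^ j) ^ k = if i = j then (n : ℂ) else 0 := by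
    intro i hi j hj
    split_ifs with hij
    · subst hij
      simp [hζ0]
    · refine sum_range_pow_eq_zero_of_pow_eq_one ?_ fun h ↦ hij ?_
      · rw [mul_pow, ← pow_mul, ← pow_mul, mul_comm i, mul_comm j, pow_mul, pow_mul, inv_pow,
          hζ.pow_eq_one]
        simp
      · refine hζ.pow_inj (Finset.mem_range.mp hi) (Finset.mem_range.mp hj) ?_
        rw [inv_pow] at h
        exact ((inv_mul_eq_one₀ (pow_ne_zero _ hζ0)).mp h)
  have hpow : ∀ i, u ^ i * star u ^ i = 1 := fun i ↦ by
    rw [← star_pow]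
    exact Unitary.mul_star_self_of_mem (pow_mem hu i)
  simp only [hterm]
  rw [← Finset.smul_sum, Finset.sum_comm]
  have hinner : ∀ i ∈ Finset.range n, ∑ k ∈ Finset.range n, ∑ j ∈ Finset.range n,
      ((ζ⁻¹ ^ i * ζ ^ j) ^ k) • (u ^ i * star u ^ j) = (n : ℂ) • (1 : A) := by
    intro i hi
    rw [Finset.sum_comm]
    simp only [← Finset.sum_smul]
    rw [Finset.sum_congr rfl fun j hj ↦ by rw [horth i hi j hj]]
    simp [ite_smul, Finset.mem_range.mp hi, hpow]
  rw [Finset.sum_congr rfl hinner, Finset.sum_const, Finset.card_range, ← Nat.cast_smul_eq_nsmul ℂ,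
    smul_smul, smul_smul]
  field_simp
  simp

lemma sum_smul_star_fourierMean {ζ : ℂ} {m : ℕ} (hζ : IsPrimitiveRoot ζ (m + 1)) (u : A) :
    ∑ k ∈ Finset.range (m + 1), ζ ^ k • star (fourierMean ζ (m + 1) u k) = star u ^ m := by
  have hnorm : ‖ζ‖ = 1 := Complex.norm_eq_one_of_pow_eq_one hζ.pow_eq_one m.succ_ne_zero
  have hterm : ∀ k, ζ ^ k • star (fourierMean ζ (m + 1) u k) =
      ((m + 1 : ℕ) : ℂ)⁻¹ • ∑ j ∈ Finset.range (m + 1), (ζ ^ (j + 1)) ^ k • star u ^ j := by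
    intro k
    rw [star_fourierMean hnorm, smul_comm, Finset.smul_sum]
    congr 1
    refine Finset.sum_congr rfl fun j _ ↦ ?_
    rw [smul_smul, ← pow_succ', ← pow_mul, ← pow_mul, mul_comm k]
  have hzero : ∀ j ∈ Finset.range m,
      (∑ k ∈ Finset.range (m + 1), (ζ ^ (j + 1)) ^ k) • star u ^ j = 0 := by
    intro j hj
    rw [sum_range_pow_eq_zero_of_pow_eq_one, zero_smul]
    · rw [← pow_mul, mul_comm, pow_mul, hζ.pow_eq_one, one_pow]
    · exact hζ.pow_ne_one_of_pos_of_lt j.succ_ne_zero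
        (Nat.succ_lt_succ (Finset.mem_range.mp hj))
  simp only [hterm]
  rw [← Finset.smul_sum, Finset.sum_comm]
  simp only [← Finset.sum_smul]
  rw [Finset.sum_range_succ, Finset.sum_eq_zero hzero, hζ.pow_eq_one, zero_add, smul_smul]
  simp only [one_pow, Finset.sum_const, Finset.card_range, nsmul_eq_mul, mul_one]
  rw [inv_mul_cancel₀ (Nat.cast_ne_zero.mpr m.succ_ne_zero), one_smul]

/-- A unitary differs from a unimodular combination of a decomposition of `1` into positive
elements by a term of size `O(1 / m)`. -/
lemma eq_sum_smul_fourierMean_mul_star_add {ζ : ℂ} {m : ℕ} (hζ : IsPrimitiveRoot ζ (m + 1)) {u : A}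
    (hu : u ∈ unitary A) :
    u = ∑ k ∈ Finset.range (m + 1),
          ζ ^ k • (fourierMean ζ (m + 1) u k * star (fourierMean ζ (m + 1) u k)) +
        ((m + 1 : ℕ) : ℂ)⁻¹ • ((u ^ (m + 1) - 1) * star u ^ m) := by
  rw [← sum_smul_star_fourierMean hζ u, Finset.mul_sum, Finset.smul_sum, ← Finset.sum_add_distrib]
  conv_lhs => rw [← mul_one u, ← sum_fourierMean_mul_star m.succ_ne_zero hζ hu, Finset.mul_sum]
  refine Finset.sum_congr rfl fun k _ ↦ ?_
  rw [← mul_assoc, mul_fourierMean m.succ_ne_zero hζ, add_mul, smul_mul_assoc, smul_mul_assoc,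
    smul_mul_assoc, mul_smul_comm, smul_comm (ζ ^ k)]

end StarAlgebra

section Hilbert

variable {H : Type*} [NormedAddCommGroup H] [InnerProductSpace ℂ H] [CompleteSpace H]

/-- Cauchy–Schwarz inequality for the form defined by a positive operator. -/
lemma ContinuousLinearMap.IsPositive.norm_inner_apply_le {T : H →L[ℂ] H} (hT : T.IsPositive)
    (φ ψ : H) :
    ‖⟪φ, T ψ⟫_ℂ‖ ≤ Real.sqrt (⟪φ, T φ⟫_ℂ).re * Real.sqrt (⟪ψ, T ψ⟫_ℂ).re := by
  obtain ⟨S, rfl⟩ := CStarAlgebra.nonneg_iff_eq_star_mul_self.mp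
    ((ContinuousLinearMap.nonneg_iff_isPositive T).mpr hT)
  have h : ∀ x y : H, ⟪x, (star S * S) y⟫_ℂ = ⟪S x, S y⟫_ℂ := fun x y ↦ by
    rw [ContinuousLinearMap.star_eq_adjoint, mul_apply_eq_comp,
      ContinuousLinearMap.adjoint_inner_right]
  have hsq : ∀ x : H, Real.sqrt (⟪S x, S x⟫_ℂ).re = ‖S x‖ := fun x ↦
    (norm_eq_sqrt_re_inner (𝕜 := ℂ) (S x)).symm
  rw [h, h, h, hsq, hsq]
  exact norm_inner_le_norm _ _

lemma norm_inner_sum_smul_apply_le {ι : Type*} (s : Finset ι) (c : ι → ℂ) (T : ι → H →L[ℂ] H)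
    (hc : ∀ i ∈ s, ‖c i‖ ≤ 1) (hT : ∀ i ∈ s, (T i).IsPositive) (φ ψ : H) :
    ‖⟪φ, (∑ i ∈ s, c i • T i) ψ⟫_ℂ‖ ≤
      Real.sqrt (⟪φ, (∑ i ∈ s, T i) φ⟫_ℂ).re * Real.sqrt (⟪ψ, (∑ i ∈ s, T i) ψ⟫_ℂ).re := by
  have hsum : ∀ x : H, (⟪x, (∑ i ∈ s, T i) x⟫_ℂ).re = ∑ i ∈ s, (⟪x, T i x⟫_ℂ).re := fun x ↦ by
    rw [sum_apply, inner_sum, Complex.re_sum]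
  rw [sum_apply, inner_sum, hsum, hsum]
  calc ‖∑ i ∈ s, ⟪φ, (c i • T i) ψ⟫_ℂ‖
      ≤ ∑ i ∈ s, Real.sqrt (⟪φ, T i φ⟫_ℂ).re * Real.sqrt (⟪ψ, T i ψ⟫_ℂ).re := by
        refine norm_sum_le_of_le s fun i hi ↦ ?_
        rw [smul_apply, inner_smul_right, norm_mul]
        exact (mul_le_of_le_one_left (norm_nonneg _) (hc i hi)).trans
          ((hT i hi).norm_inner_apply_le φ ψ)
    _ ≤ _ := by
        have h : ∀ x : H, ∀ i ∈ s, Real.sqrt (⟪x, T i x⟫_ℂ).re ^ 2 = (⟪x, T i x⟫_ℂ).re :=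
          fun x i hi ↦ Real.sq_sqrt ((hT i hi).re_inner_nonneg_right x)
        rw [← Finset.sum_congr rfl (h φ), ← Finset.sum_congr rfl (h ψ)]
        exact Real.sum_mul_le_sqrt_mul_sqrt _ _ _

end Hilbert

/-- Let `H` be a separable complex Hilbert space and let
`N : B(H) → B(H)` be a bounded linear map which is positive (i.e., maps nonnegative
operators to nonnegative operators). Then for every unitary operator `U` on `H` and
all vectors `φ, ψ ∈ H`, one has
`|⟨φ, N(U) ψ⟩| ≤ ⟨φ, N(1) φ⟩^{1/2} · ⟨ψ, N(1) ψ⟩^{1/2}`. -/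
theorem abs_inner_apply_unitary_le_of_positive
    {H : Type*} [NormedAddCommGroup H] [InnerProductSpace ℂ H] [CompleteSpace H]
    [TopologicalSpace.SeparableSpace H]
    (N : (H →L[ℂ] H) →L[ℂ] (H →L[ℂ] H))
    (hN : ∀ T : H →L[ℂ] H, T.IsPositive → (N T).IsPositive)
    (U : H →L[ℂ] H) (hU : U ∈ unitary (H →L[ℂ] H)) (φ ψ : H) :
    ‖⟪φ, (N U) ψ⟫_ℂ‖ ≤
      Real.sqrt (⟪φ, (N (1 : H →L[ℂ] H)) φ⟫_ℂ).re * Real.sqrt (⟪ψ, (N (1 : H →L[ℂ] H)) ψ⟫_ℂ).re := by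
  let R : ℕ → H →L[ℂ] H := fun m ↦
    ((m + 1 : ℕ) : ℂ)⁻¹ • ((U ^ (m + 1) - 1) * star U ^ m)
  have hnorm : ∀ V ∈ unitary (H →L[ℂ] H), ‖V‖ ≤ 1 := fun V hV ↦
    V.opNorm_le_bound zero_le_one fun x ↦ by
      rw [one_mul, ContinuousLinearMap.norm_map_of_mem_unitary hV]
  have hR : Filter.Tendsto R Filter.atTop (nhds 0) := by
    have hlim : Filter.Tendsto (fun m : ℕ ↦ 2 * (1 / ((m : ℝ) + 1))) Filter.atTop (nhds 0) := by
      simpa using tendsto_one_div_add_atTop_nhds_zero_nat (𝕜 := ℝ).const_mul 2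
    refine squeeze_zero_norm (fun m ↦ ?_) hlim
    have h1 : ‖U ^ (m + 1) - 1‖ ≤ 2 := by
      refine (norm_sub_le _ _).trans ?_
      linarith [hnorm _ (pow_mem hU (m + 1)), hnorm _ (one_mem _)]
    have h2 : ‖(U ^ (m + 1) - 1) * star U ^ m‖ ≤ 2 := by
      refine (norm_mul_le _ _).trans ?_
      have h3 := hnorm _ (pow_mem (Unitary.star_mem hU) m)
      nlinarith [norm_nonneg (U ^ (m + 1) - 1)]
    have h4 : ‖((m + 1 : ℕ) : ℂ)⁻¹‖ = 1 / ((m : ℝ) + 1) := by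
      rw [norm_inv, Complex.norm_natCast, one_div, Nat.cast_succ]
    rw [norm_smul, h4, mul_comm]
    exact mul_le_mul_of_nonneg_right h2 (by positivity)
  have hbound : ∀ m, ‖⟪φ, (N (U - R m)) ψ⟫_ℂ‖ ≤
      Real.sqrt (⟪φ, (N 1) φ⟫_ℂ).re * Real.sqrt (⟪ψ, (N 1) ψ⟫_ℂ).re := by
    intro m
    have hζ := Complex.isPrimitiveRoot_exp (m + 1) m.succ_ne_zero
    set ζ := Complex.exp (2 * Real.pi * Complex.I / ((m + 1 : ℕ) : ℂ))
    have hζn : ‖ζ‖ = 1 := Complex.norm_eq_one_of_pow_eq_one hζ.pow_eq_one m.succ_ne_zero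
    rw [sub_eq_of_eq_add (eq_sum_smul_fourierMean_mul_star_add hζ hU),
      ← sum_fourierMean_mul_star m.succ_ne_zero hζ hU, map_sum, map_sum]
    simp only [map_smul]
    refine norm_inner_sum_smul_apply_le _ _ _ (fun k _ ↦ by simp [hζn]) (fun k _ ↦ hN _ ?_) φ ψ
    exact (ContinuousLinearMap.nonneg_iff_isPositive _).mp (mul_star_self_nonneg _)
  have hcont : Continuous fun T : H →L[ℂ] H ↦ ‖⟪φ, (N (U - T)) ψ⟫_ℂ‖ := by fun_prop
  have hlim := (hcont.tendsto 0).comp hR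
  rw [sub_zero] at hlim
  exact le_of_tendsto' hlim hbound
end

section
/- Let H be a separable complex Hilbert space, let Φ : S^1 → S^1 be a bounded linear map on the trace class which is positive (maps nonnegative operators to nonnegative operators) and trace preserving (tr Φ(X) = tr X for all X ∈ S^1), and let c > 0. Assume that for every p ∈ (1,∞) and every nonnegative X ∈ S^1 one has tr Φ(X)^p ≤ c^{−(p−1)} tr X^p. Then for every nonnegative trace class operator X with −tr(X ln X) < ∞, the entropy gain satisfies −tr(Φ(X) ln Φ(X)) ≥ −tr(X ln X) + (ln c) · tr X. -/
open scoped ENNReal InnerProductSpace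

noncomputable section

variable {H : Type*} [NormedAddCommGroup H] [InnerProductSpace ℂ H] [CompleteSpace H]

/-- `tr (x ln x)₊` evaluated at `X`: the trace of the positive part of `X ln X`. -/
def trXlogXPos {ι : Type*} (b : HilbertBasis ι ℂ H) (X : H →L[ℂ] H) : ℝ≥0∞ :=
  ∑' i, ENNReal.ofReal
    (⟪b i, (cfc (fun x : ℝ => max (x * Real.log x) 0) X) (b i)⟫_ℂ).re

/-- `tr (x ln x)₋` evaluated at `X`: the trace of the negative part of `X ln X`. -/
def trXlogXNeg {ι : Type*} (b : HilbertBasis ι ℂ H) (X : H →L[ℂ] H) : ℝ≥0∞ :=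
  ∑' i, ENNReal.ofReal
    (⟪b i, (cfc (fun x : ℝ => max (-(x * Real.log x)) 0) X) (b i)⟫_ℂ).re

/-- The von Neumann entropy `−tr(X ln X) ∈ [−∞, +∞]` of a nonnegative trace class
operator `X` (with the convention `0 ln 0 = 0`); it lies in `(−∞, +∞]` and is finite
precisely when `tr (x ln x)₋` evaluated at `X` is finite. -/
def vnEntropy {ι : Type*} (b : HilbertBasis ι ℂ H) (X : H →L[ℂ] H) : EReal :=
  (trXlogXNeg b X : EReal) - (trXlogXPos b X : EReal)

/-- The diagonal matrix element `⟨bᵢ, f(X) bᵢ⟩` of `f(X)` in the Hilbert basis `b`. -/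
def diagCfc {ι : Type*} (b : HilbertBasis ι ℂ H) (X : H →L[ℂ] H) (f : ℝ → ℝ) (i : ι) : ℝ :=
  (⟪b i, (cfc f X) (b i)⟫_ℂ).re

section DiagCfc

variable {ι : Type*} (b : HilbertBasis ι ℂ H) {X : H →L[ℂ] H}

lemma spectrum_nonneg_le_norm (hX : X.IsPositive) {x : ℝ} (hx : x ∈ spectrum ℝ X) :
    0 ≤ x ∧ x ≤ ‖X‖ := by
  have h0 : 0 ≤ X := X.nonneg_iff_isPositive.mpr hX
  refine ⟨spectrum_nonneg_of_nonneg h0 hx, ?_⟩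
  rcases subsingleton_or_nontrivial H with h | h
  · have : Subsingleton (H →L[ℂ] H) := inferInstance
    simp [spectrum.of_subsingleton] at hx
  · exact (le_abs_self x).trans (spectrum.norm_le_norm_of_mem hx)

lemma diagCfc_mono (hX : X.IsPositive) {f g : ℝ → ℝ} (hf : Continuous f) (hg : Continuous g)
    (hfg : ∀ x, 0 ≤ x → x ≤ ‖X‖ → f x ≤ g x) (i : ι) :
    diagCfc b X f i ≤ diagCfc b X g i := by
  have h : cfc f X ≤ cfc g X :=
    cfc_mono (fun x hx => hfg x (spectrum_nonneg_le_norm hX hx).1 (spectrum_nonneg_le_norm hX hx).2)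
      hf.continuousOn hg.continuousOn
  have := (ContinuousLinearMap.le_def _ _).mp h |>.re_inner_nonneg_right (b i)
  simp only [sub_apply, inner_sub_right, map_sub] at this
  exact sub_nonneg.mp this

lemma diagCfc_add {f g : ℝ → ℝ} (hf : Continuous f) (hg : Continuous g) (i : ι) :
    diagCfc b X (fun x => f x + g x) i = diagCfc b X f i + diagCfc b X g i := by
  simp [diagCfc, cfc_add X f g hf.continuousOn hg.continuousOn]

lemma diagCfc_const_mul (r : ℝ) {f : ℝ → ℝ} (hf : Continuous f) (i : ι) :
    diagCfc b X (fun x => r * f x) i = r * diagCfc b X f i := by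
  simp only [diagCfc]
  rw [cfc_const_mul r f X hf.continuousOn, smul_apply,
    RCLike.real_smul_eq_coe_smul (K := ℂ), inner_smul_right]
  simp

lemma diagCfc_nonneg (hX : X.IsPositive) {f : ℝ → ℝ} (hf : Continuous f)
    (h : ∀ x, 0 ≤ x → 0 ≤ f x) (i : ι) : 0 ≤ diagCfc b X f i := by
  have := diagCfc_mono b hX (f := fun x => 0 * f x) (by fun_prop) hf
    (fun x hx _ => by simpa using h x hx) i
  rwa [diagCfc_const_mul b 0 hf, zero_mul] at this

lemma absPow_eq_cfc (hX : X.IsPositive) {q : ℝ} (hq : 0 < q) :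
    absPow X q = cfc (fun x : ℝ => x ^ q) X := by
  have hsa : IsSelfAdjoint X := hX.isSelfAdjoint
  have h1 : ContinuousLinearMap.adjoint X * X = cfc (fun x : ℝ => x ^ 2) X := by
    rw [cfc_pow_id X 2, pow_two, ← ContinuousLinearMap.star_eq_adjoint, hsa.star_eq]
  have hc : Continuous fun x : ℝ => x ^ (q / 2) := Real.continuous_rpow_const (by positivity)
  rw [absPow, h1, ← cfc_comp' (fun x : ℝ => x ^ (q / 2)) (fun x : ℝ => x ^ 2) X
    hc.continuousOn]
  refine cfc_congr fun x hx => ?_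
  have hx0 := (spectrum_nonneg_le_norm hX hx).1
  rw [← Real.rpow_natCast, ← Real.rpow_mul hx0]
  congr 1
  push_cast
  ring

lemma trAbsPow_eq_tsum_diagCfc (hX : X.IsPositive) {q : ℝ} (hq : 0 < q) :
    trAbsPow b X q = ∑' i, ENNReal.ofReal (diagCfc b X (fun x => x ^ q) i) := by
  simp only [trAbsPow, diagCfc, absPow_eq_cfc hX hq]

lemma ofReal_tsum_diagCfc (hX : X.IsPositive) {f : ℝ → ℝ} (hf : Continuous f)
    (h : ∀ x, 0 ≤ x → 0 ≤ f x) (hs : Summable (diagCfc b X f)) :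
    ∑' i, ENNReal.ofReal (diagCfc b X f i) = ENNReal.ofReal (∑' i, diagCfc b X f i) :=
  (ENNReal.ofReal_tsum_of_nonneg (diagCfc_nonneg b hX hf h) hs).symm

lemma summable_diagCfc_of_tsum_ne_top (hX : X.IsPositive) {f : ℝ → ℝ} (hf : Continuous f)
    (h : ∀ x, 0 ≤ x → 0 ≤ f x) (hs : ∑' i, ENNReal.ofReal (diagCfc b X f i) ≠ ∞) :
    Summable (diagCfc b X f) := by
  refine (ENNReal.summable_toReal hs).congr fun i => ?_
  rw [ENNReal.toReal_ofReal (diagCfc_nonneg b hX hf h i)]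

lemma summable_diagCfc_id (hX : X.IsPositive) (hX1 : trAbsPow b X 1 ≠ ∞) :
    Summable (diagCfc b X fun x => x) := by
  rw [trAbsPow_eq_tsum_diagCfc b hX one_pos] at hX1
  simp only [Real.rpow_one] at hX1
  exact summable_diagCfc_of_tsum_ne_top b hX (by fun_prop) (fun x hx => hx) hX1

/-- If `0 ≤ f(x) ≤ C x` on `[0, ‖X‖]` and `X` is trace class, then so is `f(X)`. -/
lemma summable_diagCfc_of_le (hX : X.IsPositive) (hX1 : trAbsPow b X 1 ≠ ∞) {f : ℝ → ℝ}
    (hf : Continuous f) (h : ∀ x, 0 ≤ x → 0 ≤ f x) (C : ℝ)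
    (hC : ∀ x, 0 ≤ x → x ≤ ‖X‖ → f x ≤ C * x) : Summable (diagCfc b X f) := by
  refine Summable.of_nonneg_of_le (diagCfc_nonneg b hX hf h) (fun i => ?_)
    ((summable_diagCfc_id b hX hX1).mul_left C)
  rw [← diagCfc_const_mul b C (by fun_prop)]
  exact diagCfc_mono b hX hf (by fun_prop) hC i

lemma traceC_re_eq_tsum_diagCfc (hX : X.IsPositive) :
    (traceC b X).re = ∑' i, diagCfc b X (fun x => x) i := by
  have hsa : IsSelfAdjoint X := hX.isSelfAdjoint
  have hterm : ∀ i, ⟪b i, X (b i)⟫_ℂ = ((diagCfc b X (fun x => x) i : ℝ) : ℂ) := fun i => by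
    rw [diagCfc, cfc_id' ℝ X]
    exact (Complex.conj_eq_iff_re.mp (by
      rw [inner_conj_symm]
      exact hX.isSymmetric (b i) (b i))).symm
  rw [traceC, tsum_congr hterm, ← Complex.ofReal_tsum, Complex.ofReal_re]

end DiagCfc

lemma mul_log_le_rpow_sub_div {x ε : ℝ} (hx : 0 ≤ x) (hε : 0 < ε) :
    x * Real.log x ≤ (x ^ (1 + ε) - x) / ε := by
  rcases hx.eq_or_lt with rfl | hx
  · simp [Real.zero_rpow (by positivity : 1 + ε ≠ 0)]
  rw [le_div_iff₀ hε, Real.rpow_add hx, Real.rpow_one, Real.rpow_def_of_pos hx]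
  have := mul_le_mul_of_nonneg_left (Real.add_one_le_exp (Real.log x * ε)) hx.le
  linarith

lemma rpow_one_add_le {x ε : ℝ} (hx : 0 ≤ x) (hε : 0 < ε) (hε1 : ε ≤ 1) :
    x ^ (1 + ε) ≤ x + ε * (x ^ 2 - x) := by
  have := Real.geom_mean_le_arith_mean2_weighted (sub_nonneg.mpr hε1) hε.le hx
    (sq_nonneg x) (by ring)
  rcases hx.eq_or_lt with rfl | hx
  · simp [Real.zero_rpow (by positivity : 1 + ε ≠ 0)]
  have e : x ^ (1 - ε) * (x ^ 2) ^ ε = x ^ (1 + ε) := by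
    rw [← Real.rpow_natCast x 2, ← Real.rpow_mul hx.le, ← Real.rpow_add hx]
    congr 1
    push_cast
    ring
  rw [e] at this
  linarith

lemma rpow_sub_div_le {x ε : ℝ} (hx : 0 ≤ x) (hε : 0 < ε) (hε1 : ε ≤ 1) :
    (x ^ (1 + ε) - x) / ε ≤ x ^ 2 - x := by
  rw [div_le_iff₀ hε]
  linarith [rpow_one_add_le hx hε hε1]

lemma exp_sub_one_sub_le (s : ℝ) : Real.exp s - 1 - s ≤ s ^ 2 * (1 + Real.exp s) := by
  have h1 : Real.exp s - 1 ≤ s * Real.exp s := by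
    have := mul_le_mul_of_nonneg_left (Real.add_one_le_exp (-s)) (Real.exp_pos s).le
    rw [← Real.exp_add, add_neg_cancel, Real.exp_zero] at this
    linarith
  have h2 := Real.add_one_le_exp s
  have h3 := Real.exp_pos s
  rcases le_total 0 s with h | h
  · nlinarith [mul_le_mul_of_nonneg_left h1 h]
  · nlinarith [mul_le_mul_of_nonpos_left h2 h, mul_nonneg (sq_nonneg s) h3.le]

lemma rpow_sub_div_le_mul_log_add {x ε : ℝ} (hx : 0 ≤ x) (hε : 0 < ε) (hε1 : ε ≤ 1) :
    (x ^ (1 + ε) - x) / ε ≤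
      x * Real.log x + ε * (4 * (√x * Real.log √x) ^ 2 * (1 + (1 + x))) := by
  rcases hx.eq_or_lt with rfl | hx
  · simp [Real.zero_rpow (by positivity : 1 + ε ≠ 0)]
  have hsq : 4 * (√x * Real.log √x) ^ 2 = x * Real.log x ^ 2 := by
    rw [Real.log_sqrt hx.le, mul_pow, Real.sq_sqrt hx.le]
    ring
  have hxe : x ^ ε ≤ 1 + x := by
    rcases le_total x 1 with h | h
    · linarith [Real.rpow_le_one hx.le h hε.le]
    · have := Real.rpow_le_rpow_of_exponent_le h hε1
      rw [Real.rpow_one] at this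
      linarith
  have h := exp_sub_one_sub_le (Real.log x * ε)
  rw [← Real.rpow_def_of_pos hx] at h
  have h2 : x ^ ε - 1 - Real.log x * ε ≤ (Real.log x * ε) ^ 2 * (1 + (1 + x)) :=
    h.trans (by gcongr)
  rw [hsq, div_le_iff₀ hε, Real.rpow_add hx, Real.rpow_one]
  linarith [mul_le_mul_of_nonneg_left h2 hx.le]

lemma continuous_rpow_one_add {ε : ℝ} (hε : 0 < ε) : Continuous fun x : ℝ => x ^ (1 + ε) :=
  Real.continuous_rpow_const (by positivity)

lemma continuous_max_mul_log : Continuous fun x : ℝ => max (x * Real.log x) 0 :=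
  Real.continuous_mul_log.max continuous_const

lemma continuous_max_neg_mul_log : Continuous fun x : ℝ => max (-(x * Real.log x)) 0 :=
  Real.continuous_mul_log.neg.max continuous_const

section Entropy

open Filter Topology

variable {ι : Type*} (b : HilbertBasis ι ℂ H) {X : H →L[ℂ] H}

lemma summable_diagCfc_rpow (hX : X.IsPositive) (hX1 : trAbsPow b X 1 ≠ ∞) {ε : ℝ}
    (hε : 0 < ε) (hε1 : ε ≤ 1) : Summable (diagCfc b X fun x => x ^ (1 + ε)) := by
  refine summable_diagCfc_of_le b hX hX1 (continuous_rpow_one_add hε)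
    (fun x hx => by positivity) (1 + ‖X‖) fun x hx hxX => ?_
  have h := rpow_one_add_le hx hε hε1
  nlinarith [mul_le_mul_of_nonneg_left hxX hx, mul_nonneg hε.le hx,
    mul_le_mul_of_nonneg_right hε1 (sq_nonneg x)]

lemma summable_diagCfc_mul_log_pos (hX : X.IsPositive) (hX1 : trAbsPow b X 1 ≠ ∞) :
    Summable (diagCfc b X fun x => max (x * Real.log x) 0) := by
  refine summable_diagCfc_of_le b hX hX1 continuous_max_mul_log
    (fun _ _ => le_max_right _ _) ‖X‖ fun x hx hxX => max_le ?_ (by positivity)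
  have h := (mul_log_le_rpow_sub_div hx one_pos).trans (rpow_sub_div_le hx one_pos le_rfl)
  nlinarith [mul_le_mul_of_nonneg_right hxX hx]

lemma trXlogXPos_ne_top (hX : X.IsPositive) (hX1 : trAbsPow b X 1 ≠ ∞) :
    trXlogXPos b X ≠ ∞ := by
  have := ofReal_tsum_diagCfc b hX continuous_max_mul_log
    (fun _ _ => le_max_right _ _) (summable_diagCfc_mul_log_pos b hX hX1)
  rw [show trXlogXPos b X = _ from this]
  exact ENNReal.ofReal_ne_top

lemma vnEntropy_eq_top (hX : X.IsPositive) (hX1 : trAbsPow b X 1 ≠ ∞)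
    (h : trXlogXNeg b X = ∞) : vnEntropy b X = ⊤ := by
  lift trXlogXPos b X to NNReal using trXlogXPos_ne_top b hX hX1 with r hr
  rw [vnEntropy, h, ← hr]
  rfl

lemma diagCfc_mul_log_eq (i : ι) :
    diagCfc b X (fun x => x * Real.log x) i =
      diagCfc b X (fun x => max (x * Real.log x) 0) i -
        diagCfc b X (fun x => max (-(x * Real.log x)) 0) i := by
  rw [eq_sub_iff_add_eq, ← diagCfc_add b Real.continuous_mul_log continuous_max_neg_mul_log]
  congr 1
  funext x
  rcases le_total 0 (x * Real.log x) with h | h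
  · rw [max_eq_left h, max_eq_right (by linarith), add_zero]
  · rw [max_eq_right h, max_eq_left (by linarith), add_neg_cancel]

lemma summable_diagCfc_mul_log_neg (hX : X.IsPositive) (h : trXlogXNeg b X ≠ ∞) :
    Summable (diagCfc b X fun x => max (-(x * Real.log x)) 0) :=
  summable_diagCfc_of_tsum_ne_top b hX continuous_max_neg_mul_log
    (fun _ _ => le_max_right _ _) h

lemma summable_diagCfc_mul_log (hX : X.IsPositive) (hX1 : trAbsPow b X 1 ≠ ∞)
    (h : trXlogXNeg b X ≠ ∞) : Summable (diagCfc b X fun x => x * Real.log x) :=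
  ((summable_diagCfc_mul_log_pos b hX hX1).sub (summable_diagCfc_mul_log_neg b hX h)).congr
    fun i => (diagCfc_mul_log_eq b i).symm

lemma vnEntropy_eq_neg_tsum (hX : X.IsPositive) (hX1 : trAbsPow b X 1 ≠ ∞)
    (h : trXlogXNeg b X ≠ ∞) :
    vnEntropy b X = ((-∑' i, diagCfc b X (fun x => x * Real.log x) i : ℝ) : EReal) := by
  have hp := ofReal_tsum_diagCfc b hX continuous_max_mul_log
    (fun _ _ => le_max_right _ _) (summable_diagCfc_mul_log_pos b hX hX1)
  have hn := ofReal_tsum_diagCfc b hX continuous_max_neg_mul_log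
    (fun _ _ => le_max_right _ _) (summable_diagCfc_mul_log_neg b hX h)
  rw [tsum_congr (diagCfc_mul_log_eq b), (summable_diagCfc_mul_log_pos b hX hX1).tsum_sub
    (summable_diagCfc_mul_log_neg b hX h), neg_sub, EReal.coe_sub, vnEntropy,
    show trXlogXPos b X = _ from hp, show trXlogXNeg b X = _ from hn,
    EReal.coe_ennreal_ofReal, EReal.coe_ennreal_ofReal, max_eq_left, max_eq_left]
  · exact tsum_nonneg (diagCfc_nonneg b hX continuous_max_mul_log
      fun _ _ => le_max_right _ _)
  · exact tsum_nonneg (diagCfc_nonneg b hX continuous_max_neg_mul_log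
      fun _ _ => le_max_right _ _)

lemma diagCfc_rpow_sub_div {ε : ℝ} (hε : 0 < ε) (i : ι) :
    diagCfc b X (fun x => (x ^ (1 + ε) - x) / ε) i =
      (diagCfc b X (fun x => x ^ (1 + ε)) i - diagCfc b X (fun x => x) i) / ε := by
  have hc := continuous_rpow_one_add hε
  have : (fun x : ℝ => (x ^ (1 + ε) - x) / ε) = fun x => ε⁻¹ * x ^ (1 + ε) + (-ε⁻¹) * x := by
    funext x
    ring
  rw [this, diagCfc_add b (by fun_prop) (by fun_prop), diagCfc_const_mul b _ hc,
    diagCfc_const_mul b _ continuous_id']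
  ring

lemma tsum_diagCfc_rpow_sub_div (hX : X.IsPositive) (hX1 : trAbsPow b X 1 ≠ ∞) {ε : ℝ}
    (hε : 0 < ε) (hε1 : ε ≤ 1) :
    ∑' i, diagCfc b X (fun x => (x ^ (1 + ε) - x) / ε) i =
      (∑' i, diagCfc b X (fun x => x ^ (1 + ε)) i - ∑' i, diagCfc b X (fun x => x) i) / ε := by
  rw [tsum_congr (diagCfc_rpow_sub_div b hε), tsum_div_const,
    (summable_diagCfc_rpow b hX hX1 hε hε1).tsum_sub (summable_diagCfc_id b hX hX1)]

lemma summable_diagCfc_rpow_sub_div (hX : X.IsPositive) (hX1 : trAbsPow b X 1 ≠ ∞) {ε : ℝ}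
    (hε : 0 < ε) (hε1 : ε ≤ 1) :
    Summable (diagCfc b X fun x => (x ^ (1 + ε) - x) / ε) :=
  (((summable_diagCfc_rpow b hX hX1 hε hε1).sub (summable_diagCfc_id b hX hX1)).div_const
    ε).congr fun i => (diagCfc_rpow_sub_div b hε i).symm

lemma diagCfc_mul_log_le (hX : X.IsPositive) {ε : ℝ} (hε : 0 < ε) (i : ι) :
    diagCfc b X (fun x => x * Real.log x) i ≤
      diagCfc b X (fun x => (x ^ (1 + ε) - x) / ε) i := by
  have hc := continuous_rpow_one_add hε
  exact diagCfc_mono b hX Real.continuous_mul_log (by fun_prop)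
    (fun x hx _ => mul_log_le_rpow_sub_div hx hε) i

lemma tendsto_diagCfc_rpow_sub_div (hX : X.IsPositive) (i : ι) :
    Tendsto (fun ε : ℝ => diagCfc b X (fun x => (x ^ (1 + ε) - x) / ε) i) (𝓝[>] 0)
      (𝓝 (diagCfc b X (fun x => x * Real.log x) i)) := by
  have hg : Continuous fun x : ℝ => 4 * (√x * Real.log √x) ^ 2 * (1 + (1 + x)) := by
    have : Continuous fun x : ℝ => √x * Real.log √x :=
      Real.continuous_mul_log.comp Real.continuous_sqrt
    fun_prop
  have hlim : Tendsto (fun ε : ℝ => diagCfc b X (fun x => x * Real.log x) i +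
      ε * diagCfc b X (fun x => 4 * (√x * Real.log √x) ^ 2 * (1 + (1 + x))) i) (𝓝[>] 0)
      (𝓝 (diagCfc b X (fun x => x * Real.log x) i)) := by
    refine tendsto_nhdsWithin_of_tendsto_nhds ?_
    refine Continuous.tendsto' (by fun_prop) _ _ (by simp)
  refine tendsto_of_tendsto_of_tendsto_of_le_of_le' tendsto_const_nhds hlim ?_ ?_
  · filter_upwards [self_mem_nhdsWithin] with ε hε
    exact diagCfc_mul_log_le b hX hε i
  · filter_upwards [Ioc_mem_nhdsGT one_pos] with ε hε
    have hc := continuous_rpow_one_add hε.1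
    rw [← diagCfc_const_mul b ε hg, ← diagCfc_add b Real.continuous_mul_log (by fun_prop)]
    exact diagCfc_mono b hX (by fun_prop) (Real.continuous_mul_log.add (by fun_prop))
      (fun x hx _ => rpow_sub_div_le_mul_log_add hx hε.1 hε.2) i

lemma tendsto_tsum_diagCfc_rpow_sub_div (hX : X.IsPositive) (hX1 : trAbsPow b X 1 ≠ ∞)
    (h : trXlogXNeg b X ≠ ∞) :
    Tendsto (fun ε : ℝ => ∑' i, diagCfc b X (fun x => (x ^ (1 + ε) - x) / ε) i) (𝓝[>] 0)
      (𝓝 (∑' i, diagCfc b X (fun x => x * Real.log x) i)) := by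
  refine tendsto_tsum_of_dominated_convergence
    ((summable_diagCfc_mul_log b hX hX1 h).abs.add
      (summable_diagCfc_rpow_sub_div b hX hX1 one_pos le_rfl).abs)
    (fun i => tendsto_diagCfc_rpow_sub_div b hX i) ?_
  filter_upwards [Ioc_mem_nhdsGT one_pos] with ε hε i
  have h1 := diagCfc_mul_log_le b hX hε.1 i
  have hc := continuous_rpow_one_add hε.1
  have hc1 := continuous_rpow_one_add one_pos
  have h2 : diagCfc b X (fun x => (x ^ (1 + ε) - x) / ε) i ≤
      diagCfc b X (fun x => (x ^ (1 + 1 : ℝ) - x) / 1) i := by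
    refine diagCfc_mono b hX (by fun_prop) (by fun_prop) (fun x hx _ => ?_) i
    refine (rpow_sub_div_le hx hε.1 hε.2).trans_eq ?_
    rw [div_one, one_add_one_eq_two, Real.rpow_two]
  rw [Real.norm_eq_abs]
  exact (abs_le_max_abs_abs h1 h2).trans
    (max_le_add_of_nonneg (abs_nonneg _) (abs_nonneg _))

lemma tendsto_tsum_diagCfc_rpow (hX : X.IsPositive) (hX1 : trAbsPow b X 1 ≠ ∞)
    (h : trXlogXNeg b X ≠ ∞) :
    Tendsto (fun ε : ℝ => ∑' i, diagCfc b X (fun x => x ^ (1 + ε)) i) (𝓝[>] 0)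
      (𝓝 (∑' i, diagCfc b X (fun x => x) i)) := by
  have hε : Tendsto (fun ε : ℝ => ε) (𝓝[>] 0) (𝓝 0) :=
    tendsto_nhdsWithin_of_tendsto_nhds tendsto_id
  have hlim := (hε.mul (tendsto_tsum_diagCfc_rpow_sub_div b hX hX1 h)).const_add
    (∑' i, diagCfc b X (fun x => x) i)
  rw [zero_mul, add_zero] at hlim
  refine hlim.congr' ?_
  filter_upwards [Ioc_mem_nhdsGT one_pos] with ε hε
  rw [tsum_diagCfc_rpow_sub_div b hX hX1 hε.1 hε.2, mul_div_cancel₀ _ hε.1.ne']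
  ring

end Entropy

lemma log_mul_rpow_neg_mul_le {c ε : ℝ} (hc : 0 < c) :
    Real.log c * ε * c ^ (-ε) ≤ 1 - c ^ (-ε) := by
  have h := mul_le_mul_of_nonneg_left (Real.add_one_le_exp (Real.log c * ε))
    (Real.rpow_pos_of_pos hc (-ε)).le
  rw [← Real.rpow_def_of_pos hc, ← Real.rpow_add hc, neg_add_cancel, Real.rpow_zero] at h
  linarith

lemma le_neg_tsum_mul_log_of_schatten {ι : Type*} (b : HilbertBasis ι ℂ H)
    {X Y : H →L[ℂ] H} (hX : X.IsPositive) (hX1 : trAbsPow b X 1 ≠ ∞)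
    (hY : Y.IsPositive) (hY1 : trAbsPow b Y 1 ≠ ∞) (hYn : trXlogXNeg b Y ≠ ∞)
    (htr : ∑' i, diagCfc b Y (fun x => x) i = ∑' i, diagCfc b X (fun x => x) i)
    {c ε : ℝ} (hc : 0 < c) (hε : 0 < ε) (hε1 : ε ≤ 1)
    (h : trAbsPow b Y (1 + ε) ≤ ENNReal.ofReal (c ^ (-ε)) * trAbsPow b X (1 + ε)) :
    -∑' i, diagCfc b X (fun x => (x ^ (1 + ε) - x) / ε) i +
        Real.log c * c ^ (-ε) * ∑' i, diagCfc b X (fun x => x ^ (1 + ε)) i ≤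
      -∑' i, diagCfc b Y (fun x => x * Real.log x) i := by
  have hq : (0 : ℝ) < 1 + ε := by positivity
  have hcont := continuous_rpow_one_add hε
  have hnn : ∀ x : ℝ, 0 ≤ x → 0 ≤ x ^ (1 + ε) := fun x hx => by positivity
  have hXs : 0 ≤ ∑' i, diagCfc b X (fun x => x ^ (1 + ε)) i :=
    tsum_nonneg (diagCfc_nonneg b hX hcont hnn)
  have hcp : 0 < c ^ (-ε) := Real.rpow_pos_of_pos hc _
  rw [trAbsPow_eq_tsum_diagCfc b hY hq, trAbsPow_eq_tsum_diagCfc b hX hq,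
    ofReal_tsum_diagCfc b hY hcont hnn (summable_diagCfc_rpow b hY hY1 hε hε1),
    ofReal_tsum_diagCfc b hX hcont hnn (summable_diagCfc_rpow b hX hX1 hε hε1),
    ← ENNReal.ofReal_mul hcp.le, ENNReal.ofReal_le_ofReal_iff (by positivity)] at h
  have hYle := (summable_diagCfc_mul_log b hY hY1 hYn).tsum_le_tsum
    (diagCfc_mul_log_le b hY hε) (summable_diagCfc_rpow_sub_div b hY hY1 hε hε1)
  rw [tsum_diagCfc_rpow_sub_div b hY hY1 hε hε1, htr, le_div_iff₀ hε] at hYle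
  rw [tsum_diagCfc_rpow_sub_div b hX hX1 hε hε1]
  have hl := mul_le_mul_of_nonneg_right (log_mul_rpow_neg_mul_le (ε := ε) hc) hXs
  refine le_of_mul_le_mul_right ?_ hε
  rw [add_mul, neg_mul, div_mul_cancel₀ _ hε.ne']
  linarith

/-- Let `H` be a separable complex Hilbert space, let `Φ : S¹ → S¹`
be a bounded linear map on the trace class which is positive and trace preserving, and
let `c > 0`.  Assume that for every `p ∈ (1,∞)` and every nonnegative `X ∈ S¹` one has
`tr Φ(X)^p ≤ c^{−(p−1)} tr X^p`.  Then for every nonnegative trace class operator `X`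
with `−tr(X ln X) < ∞`, the entropy gain satisfies
`−tr(Φ(X) ln Φ(X)) ≥ −tr(X ln X) + (ln c) · tr X`. -/
theorem entropy_gain_of_schatten_bound
    [TopologicalSpace.SeparableSpace H] {ι : Type*} (b : HilbertBasis ι ℂ H)
    (Φ : (H →L[ℂ] H) →ₗ[ℂ] (H →L[ℂ] H))
    (hpos : ∀ T : H →L[ℂ] H, T.IsPositive → trAbsPow b T 1 ≠ ∞ → (Φ T).IsPositive)
    (hbdd : ∃ C : ℝ≥0∞, C ≠ ∞ ∧
      ∀ T : H →L[ℂ] H, trAbsPow b (Φ T) 1 ≤ C * trAbsPow b T 1)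
    (htp : ∀ T : H →L[ℂ] H, trAbsPow b T 1 ≠ ∞ → traceC b (Φ T) = traceC b T)
    (c : ℝ) (hc : 0 < c)
    (hschatten : ∀ p : ℝ, 1 < p → ∀ X : H →L[ℂ] H, X.IsPositive →
      trAbsPow b X 1 ≠ ∞ →
      trAbsPow b (Φ X) p ≤ ENNReal.ofReal (c ^ (-(p - 1))) * trAbsPow b X p)
    (X : H →L[ℂ] H) (hX : X.IsPositive) (hX1 : trAbsPow b X 1 ≠ ∞)
    (hXent : vnEntropy b X < ⊤) :
    vnEntropy b (Φ X) ≥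
      vnEntropy b X + ((Real.log c * (traceC b X).re : ℝ) : EReal) := by
  have hY := hpos X hX hX1
  have hY1 : trAbsPow b (Φ X) 1 ≠ ∞ := by
    obtain ⟨C, hC, hle⟩ := hbdd
    exact ((hle X).trans_lt (ENNReal.mul_lt_top hC.lt_top hX1.lt_top)).ne
  by_cases hYn : trXlogXNeg b (Φ X) = ∞
  · rw [vnEntropy_eq_top b hY hY1 hYn]
    exact le_top
  have hXn : trXlogXNeg b X ≠ ∞ := fun h => hXent.ne (vnEntropy_eq_top b hX hX1 h)
  have htr : ∑' i, diagCfc b (Φ X) (fun x => x) i = ∑' i, diagCfc b X (fun x => x) i := by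
    rw [← traceC_re_eq_tsum_diagCfc b hY, ← traceC_re_eq_tsum_diagCfc b hX, htp X hX1]
  rw [ge_iff_le, vnEntropy_eq_neg_tsum b hX hX1 hXn, vnEntropy_eq_neg_tsum b hY hY1 hYn,
    ← EReal.coe_add, EReal.coe_le_coe_iff, traceC_re_eq_tsum_diagCfc b hX]
  have hcl : Filter.Tendsto (fun ε : ℝ => Real.log c * c ^ (-ε)) (nhdsWithin 0 (Set.Ioi 0))
      (nhds (Real.log c)) := by
    refine tendsto_nhdsWithin_of_tendsto_nhds (Continuous.tendsto' ?_ _ _ (by simp))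
    exact continuous_const.mul (continuous_const.rpow continuous_neg fun _ => Or.inl hc.ne')
  refine le_of_tendsto ((tendsto_tsum_diagCfc_rpow_sub_div b hX hX1 hXn).neg.add
    (hcl.mul (tendsto_tsum_diagCfc_rpow b hX hX1 hXn))) ?_
  filter_upwards [Ioc_mem_nhdsGT one_pos] with ε hε
  refine le_neg_tsum_mul_log_of_schatten b hX hX1 hY hY1 hYn htr hc hε.1 hε.2 ?_
  have := hschatten (1 + ε) (by linarith [hε.1]) X hX hX1
  rwa [add_sub_cancel_left] at this
end
end
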